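/- arXiv:math/0308251 — 3 statements merged into one kernel-verified Lean document; each statement's English description precedes it below -/
import Mathlib

section
/- Let G = {T_{C_p k} g_p : p ∈ P, k ∈ ℤ^d} and H = {T_{C_p k} h_p : p ∈ P, k ∈ ℤ^d} both be Bessel systems satisfying the local boundedness condition, and let Ω_{H,G} : L²(ℝ^d) → L²(ℝ^d), f ↦ Σ_{p∈P} Σ_{k∈ℤ^d} ⟨f, T_{C_p k} g_p⟩ T_{C_p k} h_p. Then Ω_{H,G} = 0 if and only if for all α ∈ Λ (including α = 0), Σ_{p∈P_α} |det C_p|^{-1} conj(ĝ_p(ξ)) ĥ_p(ξ+α) = 0 for a.e. ξ. -/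
open MeasureTheory Complex Matrix
open scoped FourierTransform ENNReal NNReal RealInnerProductSpace Classical

noncomputable section

namespace GSL

/-- Euclidean space `ℝ^d`. -/
abbrev Rd (d : ℕ) := EuclideanSpace ℝ (Fin d)

/-- `L²(ℝ^d, ℂ)`. -/
abbrev L2 (d : ℕ) := Lp ℂ 2 (volume : Measure (Rd d))

/-- The point of `ℝ^d` corresponding to `z ∈ ℤ^d`. -/
def zv {d : ℕ} (z : Fin d → ℤ) : Rd d :=
  (EuclideanSpace.equiv (Fin d) ℝ).symm fun i => (z i : ℝ)

/-- Apply a real `d × d` matrix to a vector of `ℝ^d`. -/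
def mApp {d : ℕ} (A : Matrix (Fin d) (Fin d) ℝ) (x : Rd d) : Rd d :=
  (EuclideanSpace.equiv (Fin d) ℝ).symm (A.mulVec (EuclideanSpace.equiv (Fin d) ℝ x))

/-- `F` is the Fourier–Plancherel transform of `L²(ℝ^d)`: the (unique) isometric isomorphism
agreeing a.e. with the Fourier integral `𝓕 f (ξ) = ∫ f x e^{-2πi x·ξ} dx` on `L¹ ∩ L²`. -/
def IsFourier {d : ℕ} (F : L2 d ≃ₗᵢ[ℂ] L2 d) : Prop :=
  ∀ f : L2 d, Integrable (f : Rd d → ℂ) volume →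
    (F f : Rd d → ℂ) =ᵐ[volume] 𝓕 (f : Rd d → ℂ)

/-- A band: a measurable set of finite Lebesgue measure. -/
def IsBand {d : ℕ} (E : Set (Rd d)) : Prop := MeasurableSet E ∧ volume E < ⊤

/-- `V_E`: elements of `L²` whose Fourier transform vanishes a.e. outside `E`. -/
def Vband {d : ℕ} (F : L2 d ≃ₗᵢ[ℂ] L2 d) (E : Set (Rd d)) : Set (L2 d) :=
  {f | ∀ᵐ ξ ∂(volume : Measure (Rd d)), ξ ∉ E → (F f : Rd d → ℂ) ξ = 0}

/-- `f₀` is the continuous representative of `f ∈ L²`. -/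
def IsCRep {d : ℕ} (f : L2 d) (f₀ : Rd d → ℂ) : Prop :=
  Continuous f₀ ∧ (f : Rd d → ℂ) =ᵐ[volume] f₀

/-- The pairing `⟨f, T_y g⟩ = ∫ f(x) conj(g(x-y)) dx` (linear in the first variable). -/
def pair {d : ℕ} (f g : L2 d) (y : Rd d) : ℂ :=
  ∫ x, (f : Rd d → ℂ) x * (starRingEnd ℂ) ((g : Rd d → ℂ) (x - y))

/-- `‖Θ_A f‖²` for the samples `{A_j z + β_j}`, computed in `[0,∞]`. -/
def sampleSum {d n : ℕ} (A : Fin n → Matrix (Fin d) (Fin d) ℝ) (β : Fin n → Rd d)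
    (f₀ : Rd d → ℂ) : ℝ≥0∞ :=
  ∑' (j : Fin n) (z : Fin d → ℤ), (‖f₀ (mApp (A j) (zv z) + β j)‖₊ : ℝ≥0∞) ^ 2

/-- `‖Θ f‖²` for the single-lattice samples `{A z + β}`. -/
def sampleSum1 {d : ℕ} (A : Matrix (Fin d) (Fin d) ℝ) (β : Rd d) (f₀ : Rd d → ℂ) : ℝ≥0∞ :=
  ∑' z : Fin d → ℤ, (‖f₀ (mApp A (zv z) + β)‖₊ : ℝ≥0∞) ^ 2

/-- The sampling transform of `{A_j z + β_j}` is (well defined and) bounded on `V_E`. -/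
def ThetaBounded {d n : ℕ} (F : L2 d ≃ₗᵢ[ℂ] L2 d) (E : Set (Rd d))
    (A : Fin n → Matrix (Fin d) (Fin d) ℝ) (β : Fin n → Rd d) : Prop :=
  ∃ M : ℝ≥0∞, M < ⊤ ∧ ∀ f ∈ Vband F E, ∀ f₀, IsCRep f f₀ →
    sampleSum A β f₀ ≤ M * (‖f‖₊ : ℝ≥0∞) ^ 2

/-- The samples `{A_j z + β_j}` are tight on the band `E` with constant `K`. -/
def Tight {d n : ℕ} (F : L2 d ≃ₗᵢ[ℂ] L2 d) (E : Set (Rd d))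
    (A : Fin n → Matrix (Fin d) (Fin d) ℝ) (β : Fin n → Rd d) (K : ℝ≥0) : Prop :=
  ∀ f ∈ Vband F E, ∀ f₀, IsCRep f f₀ →
    sampleSum A β f₀ = (K : ℝ≥0∞) * (‖f‖₊ : ℝ≥0∞) ^ 2

/-- The single-lattice samples `{A z + β}` are tight on the band `E` with constant `K`. -/
def Tight1 {d : ℕ} (F : L2 d ≃ₗᵢ[ℂ] L2 d) (E : Set (Rd d))
    (A : Matrix (Fin d) (Fin d) ℝ) (β : Rd d) (K : ℝ≥0) : Prop :=
  ∀ f ∈ Vband F E, ∀ f₀, IsCRep f f₀ →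
    sampleSum1 A β f₀ = (K : ℝ≥0∞) * (‖f‖₊ : ℝ≥0∞) ^ 2

/-- Orthogonality of the samples `{A_j z + β_j}` and `{B_j z + γ_j}` on bands `E`, `F'`:
the ranges of the two sampling transforms are orthogonal in `⊕ⁿ ℓ²(ℤ^d)`. -/
def Orth {d n : ℕ} (F : L2 d ≃ₗᵢ[ℂ] L2 d) (E F' : Set (Rd d))
    (A : Fin n → Matrix (Fin d) (Fin d) ℝ) (β : Fin n → Rd d)
    (B : Fin n → Matrix (Fin d) (Fin d) ℝ) (γ : Fin n → Rd d) : Prop :=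
  ∀ f ∈ Vband F E, ∀ g ∈ Vband F F', ∀ f₀ g₀, IsCRep f f₀ → IsCRep g g₀ →
    ∑' (j : Fin n) (z : Fin d → ℤ),
      f₀ (mApp (A j) (zv z) + β j) * (starRingEnd ℂ) (g₀ (mApp (B j) (zv z) + γ j)) = 0

/-- Single-lattice orthogonality of `{A z + β}` and `{B z + γ}` on bands `E`, `F'`. -/
def Orth1 {d : ℕ} (F : L2 d ≃ₗᵢ[ℂ] L2 d) (E F' : Set (Rd d))
    (A : Matrix (Fin d) (Fin d) ℝ) (β : Rd d)
    (B : Matrix (Fin d) (Fin d) ℝ) (γ : Rd d) : Prop :=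
  ∀ f ∈ Vband F E, ∀ g ∈ Vband F F', ∀ f₀ g₀, IsCRep f f₀ → IsCRep g g₀ →
    ∑' z : Fin d → ℤ,
      f₀ (mApp A (zv z) + β) * (starRingEnd ℂ) (g₀ (mApp B (zv z) + γ)) = 0

/-- Membership in `Λ = ∪_p C_p^{*-1} ℤ^d`. -/
def memLambda {d : ℕ} {P : Type*} (C : P → Matrix (Fin d) (Fin d) ℝ) (α : Rd d) : Prop :=
  ∃ (p : P) (z : Fin d → ℤ), α = mApp ((C p)ᵀ)⁻¹ (zv z)

/-- Membership in `P_α = {p : C_p^* α ∈ ℤ^d}`. -/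
def memPalpha {d : ℕ} {P : Type*} (C : P → Matrix (Fin d) (Fin d) ℝ) (α : Rd d) (p : P) :
    Prop :=
  ∃ z : Fin d → ℤ, mApp (C p)ᵀ α = zv z

/-- The system `{T_{C_p k} g_p}` is Bessel. -/
def Bessel {d : ℕ} {P : Type*} (C : P → Matrix (Fin d) (Fin d) ℝ) (g : P → L2 d) : Prop :=
  ∃ M : ℝ≥0∞, M < ⊤ ∧ ∀ f : L2 d,
    ∑' (p : P) (k : Fin d → ℤ), (‖pair f (g p) (mApp (C p) (zv k))‖₊ : ℝ≥0∞) ^ 2 ≤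
      M * (‖f‖₊ : ℝ≥0∞) ^ 2

/-- Membership in `D = {f ∈ L² : f̂ ∈ L^∞ with compact support}`. -/
def MemD {d : ℕ} (F : L2 d ≃ₗᵢ[ℂ] L2 d) (f : L2 d) : Prop :=
  (∃ C : ℝ, ∀ᵐ ξ ∂(volume : Measure (Rd d)), ‖(F f : Rd d → ℂ) ξ‖ ≤ C) ∧
  (∃ R : ℝ, ∀ᵐ ξ ∂(volume : Measure (Rd d)), (F f : Rd d → ℂ) ξ ≠ 0 → ‖ξ‖ ≤ R)

/-- The local boundedness condition for the system `{T_{C_p k} g_p}`. -/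
def LocBound {d : ℕ} {P : Type*} (F : L2 d ≃ₗᵢ[ℂ] L2 d)
    (C : P → Matrix (Fin d) (Fin d) ℝ) (g : P → L2 d) : Prop :=
  ∀ f : L2 d, MemD F f →
    ∑' (p : P) (k : Fin d → ℤ),
      ∫⁻ ξ in {ξ : Rd d | (F f : Rd d → ℂ) ξ ≠ 0},
        (‖(F f : Rd d → ℂ) (ξ + mApp ((C p)ᵀ)⁻¹ (zv k))‖₊ : ℝ≥0∞) ^ 2 *
          ENNReal.ofReal |(C p).det|⁻¹ * (‖(F (g p) : Rd d → ℂ) ξ‖₊ : ℝ≥0∞) ^ 2 < ⊤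

/-- `T` is the family of translation operators on `L²`: `T_y f (x) = f (x - y)`. -/
def IsTrans {d : ℕ} (T : Rd d → L2 d → L2 d) : Prop :=
  ∀ (y : Rd d) (f : L2 d),
    (T y f : Rd d → ℂ) =ᵐ[volume] fun x => (f : Rd d → ℂ) (x - y)

/-- `Ω` is the operator `f ↦ Σ_p Σ_k ⟨f, T_{C_p k} g_p⟩ T_{D_p k} h_p`
(the series converging unconditionally in `L²`). -/
def IsOmega {d : ℕ} {P : Type*} (T : Rd d → L2 d → L2 d)
    (C D : P → Matrix (Fin d) (Fin d) ℝ) (g h : P → L2 d) (Ω : L2 d → L2 d) : Prop :=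
  ∀ f : L2 d,
    HasSum (fun pk : P × (Fin d → ℤ) =>
      pair f (g pk.1) (mApp (C pk.1) (zv pk.2)) • T (mApp (D pk.1) (zv pk.2)) (h pk.1)) (Ω f)

/-- The sum `Σ_{p ∈ P_α} |det C_p|⁻¹ conj(ĝ_p(ξ)) ĥ_p(ξ + α)`. -/
def alphaSum {d : ℕ} {P : Type*} (F : L2 d ≃ₗᵢ[ℂ] L2 d)
    (C : P → Matrix (Fin d) (Fin d) ℝ) (g h : P → L2 d) (α ξ : Rd d) : ℂ :=
  ∑' p : {p : P // memPalpha C α p},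
    ((|(C p.1).det|⁻¹ : ℝ) : ℂ) * (starRingEnd ℂ) ((F (g p.1) : Rd d → ℂ) ξ) *
      (F (h p.1) : Rd d → ℂ) (ξ + α)

/-- The unit cube `[0,1]^d`. -/
def cube (d : ℕ) : Set (Rd d) := {x | ∀ i, x i ∈ Set.Icc (0 : ℝ) 1}

/-- The `C` bracket product `[f,g]_C(ξ) = Σ_m f(ξ + Cm) conj(g(ξ + Cm))`. -/
def bracket {d : ℕ} (C : Matrix (Fin d) (Fin d) ℝ) (f g : Rd d → ℂ) (ξ : Rd d) : ℂ :=
  ∑' m : Fin d → ℤ, f (ξ + mApp C (zv m)) * (starRingEnd ℂ) (g (ξ + mApp C (zv m)))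

open Real (fourierChar)
open scoped ComplexConjugate

/-- The half-open unit cube `(0,1]^d`. -/
def halfCube (d : ℕ) : Set (Fin d → ℝ) := {x | ∀ i, x i ∈ Set.Ioc (0 : ℝ) 1}

lemma measurableSet_halfCube (d : ℕ) : MeasurableSet (halfCube d) :=
  MeasurableSet.univ_pi' fun _ => measurableSet_Ioc

/-- The real vector with the given integer entries. -/
def intVec {d : ℕ} (z : Fin d → ℤ) : Fin d → ℝ := fun i => (z i : ℝ)

section Torus

local instance : MeasureSpace UnitAddCircle := ⟨AddCircle.haarAddCircle⟩

local instance : IsProbabilityMeasure (volume : Measure UnitAddCircle) :=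
  inferInstanceAs (IsProbabilityMeasure AddCircle.haarAddCircle)

/-- The section of `ℝ^d → ℝ^d/ℤ^d` with values in the half-open unit cube. -/
def torusSection {d : ℕ} : UnitAddTorus (Fin d) → Fin d → ℝ :=
  Subtype.val ∘ UnitAddTorus.measurableEquivPiIoc (0 : Fin d → ℝ)

lemma measurableEmbedding_torusSection {d : ℕ} :
    MeasurableEmbedding (torusSection (d := d)) := by
  refine MeasurableEmbedding.comp (MeasurableEmbedding.subtype_coe ?_)
    (UnitAddTorus.measurableEquivPiIoc (0 : Fin d → ℝ)).measurableEmbedding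
  exact MeasurableSet.univ_pi' fun _ => measurableSet_Ioc

lemma measurePreserving_torusSection {d : ℕ} :
    MeasurePreserving (torusSection (d := d)) volume (volume.restrict (halfCube d)) := by
  have h1 := UnitAddTorus.measurePreserving_equivPiIoc (0 : Fin d → ℝ)
  have h2 : MeasurePreserving
      (Subtype.val : {x : Fin d → ℝ // ∀ i, x i ∈ Set.Ioc ((0 : Fin d → ℝ) i) ((0 : Fin d → ℝ) i + 1)} → _)
      (Measure.comap Subtype.val volume) (volume.restrict (halfCube d)) := by
    refine ⟨measurable_subtype_coe, ?_⟩
    have := map_comap_subtype_coe (MeasurableSet.univ_pi' (fun i : Fin d =>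
      measurableSet_Ioc (a := (0 : Fin d → ℝ) i) (b := (0 : Fin d → ℝ) i + 1))) volume
    simpa [halfCube] using this
  exact h2.comp h1

lemma mFourier_eq_fourierChar {d : ℕ} (k : Fin d → ℤ) (t : UnitAddTorus (Fin d)) :
    UnitAddTorus.mFourier k t = (fourierChar (∑ i, (k i : ℝ) * torusSection t i) : ℂ) := by
  have ht : ∀ i, t i = ((torusSection t i : ℝ) : UnitAddCircle) := by
    intro i
    simp only [torusSection, Function.comp_apply, UnitAddTorus.coe_measurableEquivPiIoc_apply]
    exact ((AddCircle.equivIoc 1 ((0 : Fin d → ℝ) i)).symm_apply_apply (t i)).symm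
  simp only [UnitAddTorus.mFourier, ContinuousMap.coe_mk, Real.fourierChar_apply]
  rw [Complex.ofReal_mul, Complex.ofReal_sum, Finset.mul_sum, Finset.sum_mul, Complex.exp_sum]
  refine Finset.prod_congr rfl fun i _ => ?_
  conv_lhs => rw [ht i]
  rw [fourier_coe_apply]
  congr 1
  push_cast
  ring

/-- Parseval's identity on the unit cube. -/
lemma hasSum_fourier_halfCube {d : ℕ} {Φ Ψ : (Fin d → ℝ) → ℂ}
    (hΦ : MemLp Φ 2 (volume.restrict (halfCube d)))
    (hΨ : MemLp Ψ 2 (volume.restrict (halfCube d))) :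
    HasSum (fun k : Fin d → ℤ =>
      (∫ x in halfCube d, Φ x * (fourierChar (∑ i, (k i : ℝ) * x i) : ℂ)) *
        conj (∫ x in halfCube d, Ψ x * (fourierChar (∑ i, (k i : ℝ) * x i) : ℂ)))
      (∫ x in halfCube d, Φ x * conj (Ψ x)) := by
  have hΦ' := hΦ.comp_measurePreserving measurePreserving_torusSection
  have hΨ' := hΨ.comp_measurePreserving measurePreserving_torusSection
  have key := UnitAddTorus.hasSum_prod_mFourierCoeff (hΨ'.toLp _) (hΦ'.toLp _)
  have coeff : ∀ (G : (Fin d → ℝ) → ℂ)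
      (hG : MemLp (G ∘ torusSection) 2 (volume : Measure (UnitAddTorus (Fin d))))
      (k : Fin d → ℤ), UnitAddTorus.mFourierCoeff (hG.toLp _) (-k) =
        ∫ x in halfCube d, G x * (fourierChar (∑ i, (k i : ℝ) * x i) : ℂ) := by
    intro G hG k
    rw [← measurePreserving_torusSection.integral_comp measurableEmbedding_torusSection,
      UnitAddTorus.mFourierCoeff]
    refine integral_congr_ae ?_
    filter_upwards [hG.coeFn_toLp] with t ht
    rw [ht, neg_neg, mFourier_eq_fourierChar, smul_eq_mul, mul_comm]
    rfl
  have hint : ∫ t, conj ((hΨ'.toLp _) t) * (hΦ'.toLp _) t =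
      ∫ x in halfCube d, Φ x * conj (Ψ x) := by
    rw [← measurePreserving_torusSection.integral_comp measurableEmbedding_torusSection]
    refine integral_congr_ae ?_
    filter_upwards [hΦ'.coeFn_toLp, hΨ'.coeFn_toLp] with t ht ht'
    rw [ht, ht', mul_comm]
    rfl
  rw [hint, ← (Equiv.neg (Fin d → ℤ)).hasSum_iff] at key
  refine key.congr_fun fun k => ?_
  simp only [Function.comp_apply, Equiv.neg_apply, coeff]
  rw [mul_comm]

end Torus

lemma add_intVec_mem_iff {d : ℕ} (x : Fin d → ℝ) (j : Fin d → ℤ) :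
    x - intVec j ∈ halfCube d ↔ (fun i => ⌈x i⌉ - 1) = j := by
  simp only [halfCube, Set.mem_ofPred_eq, Set.mem_Ioc, funext_iff, intVec, Pi.sub_apply]
  refine forall_congr' fun i => ?_
  rw [sub_eq_iff_eq_add, Int.ceil_eq_iff]
  push_cast
  constructor <;> rintro ⟨h1, h2⟩ <;> constructor <;> linarith

/-- Integration over `ℝ^d` by summation over the integer translates of the unit cube. -/
lemma hasSum_integral_translates {d : ℕ} {G : (Fin d → ℝ) → ℂ} (hG : Integrable G) :
    HasSum (fun j : Fin d → ℤ => ∫ x in halfCube d, G (x + intVec j)) (∫ x, G x) := by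
  have hm : ∀ j : Fin d → ℤ, MeasurableSet ((fun x => x - intVec j) ⁻¹' halfCube d) := fun j =>
    (measurable_id.sub_const _) (measurableSet_halfCube d)
  have hU : ⋃ j : Fin d → ℤ, ((fun x => x - intVec j) ⁻¹' halfCube d) = Set.univ := by
    refine Set.eq_univ_of_forall fun x => Set.mem_iUnion.2 ⟨fun i => ⌈x i⌉ - 1, ?_⟩
    exact (add_intVec_mem_iff x _).2 rfl
  have hd : Pairwise (Function.onFun Disjoint
      fun j : Fin d → ℤ => ((fun x => x - intVec j) ⁻¹' halfCube d)) := by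
    intro j l hjl
    refine Set.disjoint_left.2 fun x hx hx' => hjl ?_
    exact ((add_intVec_mem_iff x j).1 hx).symm.trans ((add_intVec_mem_iff x l).1 hx')
  have key := hasSum_integral_iUnion (f := G) (μ := volume) hm hd (by rw [hU]; exact hG.integrableOn)
  rw [hU, setIntegral_univ] at key
  refine key.congr_fun fun j => ?_
  have := (measurePreserving_add_right (volume : Measure (Fin d → ℝ)) (intVec j)).setIntegral_preimage_emb
    (measurableEmbedding_addRight (intVec j)) G ((fun x => x - intVec j) ⁻¹' halfCube d)
  rw [← this]
  congr 3
  ext x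
  simp

lemma integral_eq_sum_translates {d : ℕ} {G : (Fin d → ℝ) → ℂ} (hG : Integrable G)
    {J : Finset (Fin d → ℤ)} (hJ : ∀ j ∉ J, ∀ x ∈ halfCube d, G (x + intVec j) = 0) :
    ∫ x, G x = ∑ j ∈ J, ∫ x in halfCube d, G (x + intVec j) := by
  refine (hasSum_integral_translates hG).unique (hasSum_sum_of_ne_finset_zero fun j hj => ?_)
  exact setIntegral_eq_zero_of_forall_eq_zero fun x hx => hJ j hj x hx

lemma fourierChar_int {n : ℤ} : fourierChar (n : ℝ) = 1 := by
  ext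
  rw [Real.fourierChar_apply]
  rw [Circle.coe_one, ← Complex.exp_int_mul_two_pi_mul_I n]
  congr 1
  push_cast
  ring

lemma fourierChar_sum_add_intVec {d : ℕ} (k j : Fin d → ℤ) (x : Fin d → ℝ) :
    (fourierChar (∑ i, (k i : ℝ) * (x + intVec j) i) : ℂ) =
      fourierChar (∑ i, (k i : ℝ) * x i) := by
  have : ∑ i, (k i : ℝ) * (x + intVec j) i =
      ∑ i, (k i : ℝ) * x i + ((∑ i, k i * j i : ℤ) : ℝ) := by
    push_cast
    simp [intVec, mul_add, Finset.sum_add_distrib]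
  rw [this, AddChar.map_add_eq_mul, fourierChar_int, mul_one]

lemma _root_.MeasureTheory.MemLp.mul_circle {α : Type*} [TopologicalSpace α] [MeasurableSpace α]
    [OpensMeasurableSpace α] {μ : Measure α} {p : ℝ≥0∞} {f : α → ℂ} (hf : MemLp f p μ)
    {c : α → Circle} (hc : Continuous c) :
    MemLp (fun x => f x * (c x : ℂ)) p μ := by
  refine hf.of_le (hf.1.mul ?_) (Filter.Eventually.of_forall fun x => by simp [Circle.norm_coe])
  exact (continuous_subtype_val.comp hc).aestronglyMeasurable

lemma continuous_fourierChar_sum {d : ℕ} (k : Fin d → ℤ) :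
    Continuous fun x : Fin d → ℝ => fourierChar (∑ i, (k i : ℝ) * x i) :=
  Real.continuous_fourierChar.comp (by fun_prop)

lemma memLp_translate {d : ℕ} {φ : (Fin d → ℝ) → ℂ} (hφ : MemLp φ 2) (j : Fin d → ℤ) :
    MemLp (fun x => φ (x + intVec j)) 2 (volume.restrict (halfCube d)) :=
  (hφ.comp_measurePreserving (measurePreserving_add_right volume (intVec j))).restrict _

instance (d : ℕ) : IsFiniteMeasure ((volume : Measure (Fin d → ℝ)).restrict (halfCube d)) := by
  refine ⟨?_⟩
  rw [Measure.restrict_apply_univ]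
  have : halfCube d = Set.pi Set.univ fun _ => Set.Ioc (0 : ℝ) 1 := by
    ext x; simp [halfCube]
  rw [this, volume_pi_pi]
  simp

lemma integral_mul_fourierChar_eq {d : ℕ} {φ : (Fin d → ℝ) → ℂ} (hφ : MemLp φ 2)
    (hφ' : Integrable φ) {J : Finset (Fin d → ℤ)}
    (hJ : ∀ j ∉ J, ∀ x ∈ halfCube d, φ (x + intVec j) = 0) (k : Fin d → ℤ) :
    ∫ x, φ x * (fourierChar (∑ i, (k i : ℝ) * x i) : ℂ) =
      ∫ x in halfCube d, (∑ j ∈ J, φ (x + intVec j)) * (fourierChar (∑ i, (k i : ℝ) * x i) : ℂ) := by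
  have hint : Integrable fun x => φ x * (fourierChar (∑ i, (k i : ℝ) * x i) : ℂ) := by
    rw [← memLp_one_iff_integrable] at hφ' ⊢
    exact hφ'.mul_circle (continuous_fourierChar_sum k)
  rw [integral_eq_sum_translates hint (J := J) (fun j hj x hx => by rw [hJ j hj x hx, zero_mul])]
  simp_rw [fourierChar_sum_add_intVec, Finset.sum_mul]
  rw [integral_finsetSum]
  intro j _
  exact ((memLp_translate hφ j).mul_circle (continuous_fourierChar_sum k)).integrable (by norm_num)

/-- Parseval's identity for periodizations, over the lattice `ℤ^d`. -/
lemma exists_hasSum_periodization {d : ℕ} {φ ψ : (Fin d → ℝ) → ℂ} (hφ : MemLp φ 2)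
    (hψ : MemLp ψ 2) (hφ' : Integrable φ) (hψ' : Integrable ψ) {J : Finset (Fin d → ℤ)}
    (hJφ : ∀ j ∉ J, ∀ x ∈ halfCube d, φ (x + intVec j) = 0)
    (hJψ : ∀ j ∉ J, ∀ x ∈ halfCube d, ψ (x + intVec j) = 0) :
    ∃ S : ℂ, HasSum (fun k : Fin d → ℤ =>
      (∫ x, φ x * (fourierChar (∑ i, (k i : ℝ) * x i) : ℂ)) *
        conj (∫ x, ψ x * (fourierChar (∑ i, (k i : ℝ) * x i) : ℂ))) S ∧
      HasSum (fun m : Fin d → ℤ => ∫ x, φ x * conj (ψ (x + intVec m))) S := by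
  refine ⟨∑ j ∈ J, ∑ l ∈ J, ∫ x in halfCube d, φ (x + intVec j) * conj (ψ (x + intVec l)),
    ?_, ?_⟩
  · have hint : ∀ j l : Fin d → ℤ, Integrable
        (fun x => φ (x + intVec j) * conj (ψ (x + intVec l))) (volume.restrict (halfCube d)) :=
      fun j l => (memLp_translate hφ j).integrable_mul (memLp_translate hψ l).star
    have key := hasSum_fourier_halfCube
      (memLp_finsetSum J fun j _ => memLp_translate hφ j)
      (memLp_finsetSum J fun j _ => memLp_translate hψ j)
    simp_rw [map_sum, Finset.sum_mul_sum] at key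
    rw [integral_finsetSum _ fun j _ => integrable_finsetSum _ fun l _ => hint j l] at key
    simp_rw [integral_finsetSum _ fun l _ => hint _ l] at key
    refine key.congr_fun fun k => ?_
    rw [integral_mul_fourierChar_eq hφ hφ' hJφ, integral_mul_fourierChar_eq hψ hψ' hJψ]
  · have hprod : ∀ m : Fin d → ℤ, Integrable fun x => φ x * conj (ψ (x + intVec m)) := fun m =>
      hφ.integrable_mul
        (hψ.comp_measurePreserving (measurePreserving_add_right volume (intVec m))).star
    have hm : ∀ m : Fin d → ℤ, ∫ x, φ x * conj (ψ (x + intVec m)) =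
        ∑ j ∈ J, ∫ x in halfCube d, φ (x + intVec j) * conj (ψ (x + intVec (j + m))) := by
      intro m
      rw [integral_eq_sum_translates (hprod m) (J := J)
        fun j hj x hx => by rw [hJφ j hj x hx, zero_mul]]
      refine Finset.sum_congr rfl fun j _ => ?_
      have hadd : intVec (j + m) = intVec j + intVec m := by
        ext i
        simp [intVec]
      simp_rw [hadd, add_assoc]
    simp_rw [hm]
    refine hasSum_sum fun j _ => ?_
    have : HasSum (fun l : Fin d → ℤ =>
        ∫ x in halfCube d, φ (x + intVec j) * conj (ψ (x + intVec l)))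
        (∑ l ∈ J, ∫ x in halfCube d, φ (x + intVec j) * conj (ψ (x + intVec l))) := by
      refine hasSum_sum_of_ne_finset_zero fun l hl => ?_
      refine setIntegral_eq_zero_of_forall_eq_zero fun x hx => ?_
      rw [hJψ l hl x hx, map_zero, mul_zero]
    exact (Equiv.addLeft j).hasSum_iff.2 this

lemma mApp_eq {d : ℕ} (A : Matrix (Fin d) (Fin d) ℝ) (x : Rd d) :
    mApp A x = WithLp.toLp 2 (A.mulVec (WithLp.ofLp x)) := rfl

lemma zv_eq {d : ℕ} (z : Fin d → ℤ) : zv z = WithLp.toLp 2 (intVec z) := rfl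

/-- The map `η ↦ C' η` from `ℝ^d` with its product structure to Euclidean space. -/
def dualMap {d : ℕ} (C : Matrix (Fin d) (Fin d) ℝ) (x : Fin d → ℝ) : Rd d :=
  WithLp.toLp 2 ((Cᵀ)⁻¹.mulVec x)

lemma dualMap_add_intVec {d : ℕ} (C : Matrix (Fin d) (Fin d) ℝ) (x : Fin d → ℝ)
    (m : Fin d → ℤ) :
    dualMap C (x + intVec m) = dualMap C x + mApp (Cᵀ)⁻¹ (zv m) := by
  simp [dualMap, mApp_eq, zv_eq, Matrix.mulVec_add]

lemma inner_mApp_dualMap {d : ℕ} {C : Matrix (Fin d) (Fin d) ℝ} (hC : IsUnit C.det)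
    (k : Fin d → ℤ) (x : Fin d → ℝ) :
    inner ℝ (mApp C (zv k)) (dualMap C x) = ∑ i, (k i : ℝ) * x i := by
  have hCt : IsUnit (Cᵀ).det := by rwa [Matrix.det_transpose]
  rw [mApp_eq, zv_eq, dualMap, EuclideanSpace.inner_toLp_toLp]
  simp only [star_trivial]
  rw [dotProduct_comm, ← Matrix.vecMul_transpose C, ← Matrix.dotProduct_mulVec,
    Matrix.mulVec_mulVec, Matrix.mul_nonsing_inv _ hCt, Matrix.one_mulVec]
  rfl

lemma continuous_dualMap {d : ℕ} (C : Matrix (Fin d) (Fin d) ℝ) : Continuous (dualMap C) := by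
  unfold dualMap
  fun_prop

lemma injective_dualMap {d : ℕ} {C : Matrix (Fin d) (Fin d) ℝ} (hC : IsUnit C.det) :
    Function.Injective (dualMap C) := by
  have hCt : IsUnit (Cᵀ).det := by rwa [Matrix.det_transpose]
  intro x y hxy
  have := congrArg (fun v : Rd d => (Cᵀ).mulVec (WithLp.ofLp v)) hxy
  simpa [dualMap, Matrix.mulVec_mulVec, Matrix.mul_nonsing_inv _ hCt] using this

lemma map_dualMap_volume {d : ℕ} {C : Matrix (Fin d) (Fin d) ℝ} (hC : IsUnit C.det) :
    Measure.map (dualMap C) volume = ENNReal.ofReal |C.det| • (volume : Measure (Rd d)) := by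
  have hdet : ((Cᵀ)⁻¹).det ≠ 0 := by
    rw [Matrix.det_nonsing_inv, Matrix.det_transpose, Ring.inverse_eq_inv']
    exact inv_ne_zero hC.ne_zero
  have h1 := Real.map_matrix_volume_pi_eq_smul_volume_pi hdet
  have h2 : dualMap C = (WithLp.toLp 2) ∘ (Matrix.toLin' (Cᵀ)⁻¹) := by
    ext x
    simp [dualMap]
  rw [h2, ← Measure.map_map (PiLp.volume_preserving_toLp (Fin d)).measurable
    (Matrix.toLin' (Cᵀ)⁻¹).continuous_of_finiteDimensional.measurable, h1, Measure.map_smul,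
    (PiLp.volume_preserving_toLp (Fin d)).map_eq, Matrix.det_nonsing_inv, Matrix.det_transpose,
    Ring.inverse_eq_inv', inv_inv]

lemma integral_eq_integral_dualMap {d : ℕ} {C : Matrix (Fin d) (Fin d) ℝ} (hC : IsUnit C.det)
    (G : Rd d → ℂ) :
    ∫ ξ, G ξ = ((|C.det|⁻¹ : ℝ) : ℂ) * ∫ x, G (dualMap C x) := by
  have hemb : MeasurableEmbedding (dualMap C) :=
    (continuous_dualMap C).measurableEmbedding (injective_dualMap hC)
  rw [← hemb.integral_map, map_dualMap_volume hC, integral_smul_measure,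
    ENNReal.toReal_ofReal (abs_nonneg _), Complex.real_smul, ← mul_assoc, ← Complex.ofReal_mul,
    inv_mul_cancel₀ (abs_ne_zero.2 hC.ne_zero), Complex.ofReal_one, one_mul]

lemma memLp_comp_dualMap {d : ℕ} {C : Matrix (Fin d) (Fin d) ℝ} (hC : IsUnit C.det)
    {G : Rd d → ℂ} {p : ℝ≥0∞} (hG : MemLp G p) : MemLp (fun x => G (dualMap C x)) p := by
  have h : MemLp G p (Measure.map (dualMap C) volume) := by
    rw [map_dualMap_volume hC]
    exact hG.smul_measure ENNReal.ofReal_ne_top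
  exact h.comp_of_map (continuous_dualMap C).measurable.aemeasurable

lemma exists_finset_translates {d : ℕ} {C : Matrix (Fin d) (Fin d) ℝ} (hC : IsUnit C.det)
    (R : ℝ) : ∃ J : Finset (Fin d → ℤ), ∀ j ∉ J, ∀ x ∈ halfCube d,
      R < ‖dualMap C (x + intVec j)‖ := by
  have hCt : IsUnit (Cᵀ).det := by rwa [Matrix.det_transpose]
  have hcont : Continuous fun v : Rd d => (Cᵀ).mulVec (WithLp.ofLp v) := by fun_prop
  obtain ⟨K, hK⟩ := ((isCompact_closedBall (0 : Rd d) R).image hcont).isBounded.exists_norm_le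
  obtain ⟨N, hN⟩ := exists_nat_ge (K + 1)
  refine ⟨Fintype.piFinset fun _ => Finset.Icc (-(N : ℤ)) N, fun j hj x hx => ?_⟩
  by_contra! hle
  refine hj (Fintype.mem_piFinset.2 fun i => ?_)
  have hb := hK _ ⟨dualMap C (x + intVec j), by simpa using hle, rfl⟩
  simp only [dualMap, Matrix.mulVec_mulVec, Matrix.mul_nonsing_inv _ hCt, Matrix.one_mulVec] at hb
  have hi := (norm_le_pi_norm (x + intVec j) i).trans hb
  rw [Real.norm_eq_abs, abs_le] at hi
  simp only [Pi.add_apply, intVec] at hi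
  have hxi := hx i
  rw [Finset.mem_Icc]
  constructor
  · have : (-(N : ℤ) : ℝ) ≤ j i := by push_cast; linarith [hi.1, hxi.2]
    exact_mod_cast this
  · have : (j i : ℝ) ≤ (N : ℤ) := by push_cast; linarith [hi.2, hxi.1]
    exact_mod_cast this

/-- Parseval's identity for periodizations, over the lattice dual to `C ℤ^d`. -/
lemma exists_hasSum_lattice {d : ℕ} {C : Matrix (Fin d) (Fin d) ℝ} (hC : IsUnit C.det)
    {φ ψ : Rd d → ℂ} (hφ : MemLp φ 2) (hψ : MemLp ψ 2) (hφ' : Integrable φ) (hψ' : Integrable ψ)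
    {R : ℝ} (hRφ : ∀ ξ, R < ‖ξ‖ → φ ξ = 0) (hRψ : ∀ ξ, R < ‖ξ‖ → ψ ξ = 0) :
    ∃ S : ℂ, HasSum (fun k : Fin d → ℤ =>
      (∫ ξ, φ ξ * (fourierChar (inner ℝ (mApp C (zv k)) ξ) : ℂ)) *
        conj (∫ ξ, ψ ξ * (fourierChar (inner ℝ (mApp C (zv k)) ξ) : ℂ))) S ∧
      HasSum (fun m : Fin d → ℤ => ((|C.det|⁻¹ : ℝ) : ℂ) *
        ∫ ξ, φ ξ * conj (ψ (ξ + mApp (Cᵀ)⁻¹ (zv m)))) S := by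
  obtain ⟨J, hJ⟩ := exists_finset_translates hC R
  rw [← memLp_one_iff_integrable] at hφ' hψ'
  obtain ⟨S, h1, h2⟩ := exists_hasSum_periodization (memLp_comp_dualMap hC hφ)
    (memLp_comp_dualMap hC hψ) (memLp_one_iff_integrable.1 (memLp_comp_dualMap hC hφ'))
    (memLp_one_iff_integrable.1 (memLp_comp_dualMap hC hψ')) (J := J)
    (fun j hj x hx => hRφ _ (hJ j hj x hx)) (fun j hj x hx => hRψ _ (hJ j hj x hx))
  refine ⟨((|C.det|⁻¹ : ℝ) : ℂ) * (((|C.det|⁻¹ : ℝ) : ℂ) * S), ?_, ?_⟩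
  · refine ((h1.mul_left _).mul_left _).congr_fun fun k => ?_
    rw [integral_eq_integral_dualMap hC, integral_eq_integral_dualMap hC, map_mul,
      Complex.conj_ofReal]
    simp_rw [inner_mApp_dualMap hC]
    ring
  · refine ((h2.mul_left _).mul_left _).congr_fun fun m => ?_
    rw [integral_eq_integral_dualMap hC]
    simp_rw [dualMap_add_intVec]

/-- An absolutely summable generalized Fourier series which vanishes identically has vanishing
coefficients, once equal frequencies are grouped together. -/
lemma tsum_coeff_eq_zero {ι : Type*} [Countable ι] {d : ℕ} {c : ι → ℂ} {α : ι → Rd d}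
    (hc : Summable fun i => ‖c i‖)
    (h0 : ∀ x, ∑' i, c i * (fourierChar (inner ℝ (α i) x) : ℂ) = 0) (β : Rd d) :
    ∑' i : {i // α i = β}, c i = 0 := by
  let G : ℝ → ι → Rd d → ℂ := fun b i x =>
    cexp (-(b : ℂ) * ‖x‖ ^ 2 + (2 * Real.pi * I) * (inner ℝ (α i - β) x : ℝ))
  have hnorm : ∀ b i x, ‖G b i x‖ = Real.exp (-b * ‖x‖ ^ 2) := by
    intro b i x
    simp only [G, Complex.norm_exp]
    congr 1
    simp [← Complex.ofReal_pow]
  have hint : ∀ b : ℝ, 0 < b → ∀ i, Integrable (G b i) := fun b hb i =>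
    GaussianFourier.integrable_cexp_neg_mul_sq_norm_add (b := (b : ℂ)) (by simpa using hb) _ _
  have hsum : ∀ b : ℝ, 0 < b →
      ∑' i, c i * (Real.exp (-(Real.pi ^ 2 * ‖α i - β‖ ^ 2 / b)) : ℂ) = 0 := by
    intro b hb
    have hbc : 0 < (b : ℂ).re := by simpa using hb
    have hb0 : (b : ℂ) ≠ 0 := by exact_mod_cast hb.ne'
    have key := hasSum_integral_of_summable_integral_norm
      (F := fun i x => c i * G b i x) (μ := volume) (fun i => (hint b hb i).const_mul _) (by
        simp_rw [norm_mul, hnorm, integral_const_mul]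
        exact hc.mul_right _)
    have hz : ∀ x, ∑' i, c i * G b i x = 0 := by
      intro x
      have : ∀ i, c i * G b i x = c i * (fourierChar (inner ℝ (α i) x) : ℂ) *
          cexp (-(b : ℂ) * ‖x‖ ^ 2 - (2 * Real.pi * I) * (inner ℝ β x : ℝ)) := by
        intro i
        rw [Real.fourierChar_apply, mul_assoc, ← Complex.exp_add]
        simp only [G, inner_sub_left]
        congr 2
        push_cast
        ring
      simp_rw [this, tsum_mul_right, h0, zero_mul]
    simp_rw [hz, integral_zero, integral_const_mul, G,
      GaussianFourier.integral_cexp_neg_mul_sq_norm_add hbc] at key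
    have hne : ((Real.pi : ℂ) / b) ^ ((Module.finrank ℝ (Rd d) : ℂ) / 2) ≠ 0 := by
      have : ((Real.pi : ℂ) / b) ≠ 0 := div_ne_zero (by exact_mod_cast Real.pi_ne_zero) hb0
      rw [Ne, Complex.cpow_eq_zero_iff]
      exact fun h => this h.1
    have h2 := key.tsum_eq
    have : ∀ i, c i * (((Real.pi : ℂ) / b) ^ ((Module.finrank ℝ (Rd d) : ℂ) / 2) *
        cexp ((2 * Real.pi * I) ^ 2 * (‖α i - β‖ : ℂ) ^ 2 / (4 * b))) =
        (c i * (Real.exp (-(Real.pi ^ 2 * ‖α i - β‖ ^ 2 / b)) : ℂ)) *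
          ((Real.pi : ℂ) / b) ^ ((Module.finrank ℝ (Rd d) : ℂ) / 2) := by
      intro i
      have he : (2 * Real.pi * I) ^ 2 * (‖α i - β‖ : ℂ) ^ 2 / (4 * b) =
          ((-(Real.pi ^ 2 * ‖α i - β‖ ^ 2 / b) : ℝ) : ℂ) := by
        push_cast
        field_simp
        linear_combination (4 * (‖α i - β‖ : ℂ) ^ 2) * Complex.I_sq
      rw [he, Complex.ofReal_exp]
      ring
    simp_rw [this, tsum_mul_right] at h2
    exact (mul_eq_zero.1 h2).resolve_right hne
  have hlim : Filter.Tendsto (fun n : ℕ => ∑' i,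
      c i * (Real.exp (-(Real.pi ^ 2 * ‖α i - β‖ ^ 2 / (1 / ((n : ℝ) + 1)))) : ℂ))
      Filter.atTop (nhds (∑' i, {i | α i = β}.indicator c i)) :=
    tendsto_tsum_of_dominated_convergence hc (fun i => by
      by_cases hi : α i = β
      · simp [hi]
      · rw [Set.indicator_of_notMem (by exact hi)]
        have hpos : 0 < Real.pi ^ 2 * ‖α i - β‖ ^ 2 := by
          have := norm_pos_iff.2 (sub_ne_zero.2 hi)
          positivity
        have h1 : Filter.Tendsto
            (fun n : ℕ => Real.exp (-(Real.pi ^ 2 * ‖α i - β‖ ^ 2 / (1 / ((n : ℝ) + 1)))))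
            Filter.atTop (nhds 0) := by
          simp_rw [div_div_eq_mul_div, div_one]
          refine Real.tendsto_exp_neg_atTop_nhds_zero.comp
            (Filter.Tendsto.const_mul_atTop hpos ?_)
          exact Filter.tendsto_atTop_add_const_right _ _ tendsto_natCast_atTop_atTop
        have h2 := ((Complex.continuous_ofReal.tendsto 0).comp h1).const_mul (c i)
        simpa using h2) (Filter.Eventually.of_forall fun n i => by
      rw [norm_mul, Complex.norm_real, Real.norm_eq_abs, Real.abs_exp]
      refine mul_le_of_le_one_right (norm_nonneg _) (Real.exp_le_one_iff.2 ?_)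
      rw [neg_nonpos]
      positivity)
  simp_rw [fun n : ℕ => hsum (1 / ((n : ℝ) + 1)) (by positivity)] at hlim
  have := tendsto_nhds_unique hlim tendsto_const_nhds
  rwa [← tsum_subtype] at this

section Fourier

variable {d : ℕ} {F : L2 d ≃ₗᵢ[ℂ] L2 d} {T : Rd d → L2 d → L2 d}

lemma trans_eq_compMeasurePreserving (hT : IsTrans T) (y : Rd d) (f : L2 d) :
    T y f = Lp.compMeasurePreserving (fun x => x - y) (measurePreserving_sub_right volume y) f := by
  refine Lp.ext ?_
  filter_upwards [hT y f, Lp.coeFn_compMeasurePreserving f (measurePreserving_sub_right volume y)]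
    with x h1 h2
  rw [h1, h2]
  rfl

/-- Multiplication by the character `ξ ↦ e^{-2πi y·ξ}` on `L²`. -/
def modulation (y : Rd d) (f : L2 d) : L2 d :=
  ((Lp.memLp f).mul_circle (c := fun ξ => fourierChar (-inner ℝ y ξ))
    (Real.continuous_fourierChar.comp (by fun_prop))).toLp _

lemma coeFn_modulation (y : Rd d) (f : L2 d) :
    modulation y f =ᵐ[volume] fun ξ => f ξ * (fourierChar (-inner ℝ y ξ) : ℂ) :=
  MemLp.coeFn_toLp _

lemma modulation_add (y : Rd d) (f g : L2 d) :
    modulation y (f + g) = modulation y f + modulation y g := by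
  refine Lp.ext ?_
  filter_upwards [coeFn_modulation y (f + g), coeFn_modulation y f, coeFn_modulation y g,
    Lp.coeFn_add f g, Lp.coeFn_add (modulation y f) (modulation y g)] with ξ h1 h2 h3 h4 h5
  rw [h1, h4, h5, Pi.add_apply, Pi.add_apply, h2, h3, add_mul]

lemma continuous_modulation (y : Rd d) : Continuous (modulation y) := by
  refine LipschitzWith.continuous (K := 1) (LipschitzWith.of_dist_le_mul fun f g => ?_)
  rw [NNReal.coe_one, one_mul, dist_eq_norm, dist_eq_norm]
  refine Lp.norm_le_norm_of_ae_le ?_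
  filter_upwards [coeFn_modulation y f, coeFn_modulation y g,
    Lp.coeFn_sub f g, Lp.coeFn_sub (modulation y f) (modulation y g)] with ξ h2 h3 h4 h5
  rw [h4, h5, Pi.sub_apply, Pi.sub_apply, h2, h3, ← sub_mul, norm_mul, Circle.norm_coe, mul_one]

lemma fourier_trans_of_integrable (hF : IsFourier F) (hT : IsTrans T) (y : Rd d) {f : L2 d}
    (hf : Integrable f) : F (T y f) = modulation y (F f) := by
  have hTf : Integrable (T y f) := (hf.comp_sub_right y).congr (hT y f).symm
  refine Lp.ext ?_
  filter_upwards [hF _ hTf, hF _ hf, coeFn_modulation y (F f)] with ξ h1 h2 h3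
  rw [h1, h3, h2]
  have h4 : 𝓕 (T y f : Rd d → ℂ) ξ = 𝓕 (fun x => (f : Rd d → ℂ) (x - y)) ξ := by
    rw [Real.fourier_eq, Real.fourier_eq]
    refine integral_congr_ae ?_
    filter_upwards [hT y f] with x hx
    rw [hx]
  rw [h4, Real.fourier_eq, Real.fourier_eq, ← integral_add_right_eq_self _ y, ← integral_mul_const]
  refine integral_congr_ae (Filter.Eventually.of_forall fun x => ?_)
  simp only [add_sub_cancel_right, inner_add_left, neg_add, AddChar.map_add_eq_mul,
    Circle.smul_def, Circle.coe_mul, smul_eq_mul]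
  ring

/-- The Fourier transform intertwines translations and modulations. -/
lemma fourier_trans (hF : IsFourier F) (hT : IsTrans T) (y : Rd d) (f : L2 d) :
    F (T y f) = modulation y (F f) := by
  have hTc : Continuous (T y) := by
    simp_rw [funext (trans_eq_compMeasurePreserving hT y)]
    exact (Lp.isometry_compMeasurePreserving _).continuous
  have hTadd : ∀ a b : L2 d, T y (a + b) = T y a + T y b := by
    simp [trans_eq_compMeasurePreserving hT y]
  refine Lp.induction (by norm_num) (motive := fun f => F (T y f) = modulation y (F f))
    ?_ ?_ ?_ f
  · intro c s hs hμ
    refine fourier_trans_of_integrable hF hT y ?_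
    refine (((integrable_indicator_iff hs).2 (integrableOn_const (C := c) hμ.ne))).congr ?_
    exact (indicatorConstLp_coeFn (p := 2) (hs := hs) (hμs := hμ.ne) (c := c)).symm
  · intro f g hf hg _ h1 h2
    rw [hTadd, map_add, map_add, modulation_add, h1, h2]
  · exact isClosed_eq (F.continuous.comp hTc) ((continuous_modulation y).comp F.continuous)

lemma pair_eq_inner (hT : IsTrans T) (f g : L2 d) (y : Rd d) :
    pair f g y = inner ℂ (T y g) f := by
  rw [L2.inner_def, pair]
  refine integral_congr_ae ?_
  filter_upwards [hT y g] with x hx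
  rw [RCLike.inner_apply, hx]

/-- Plancherel's formula for the pairing. -/
lemma pair_eq_integral (hF : IsFourier F) (hT : IsTrans T) (f g : L2 d) (y : Rd d) :
    pair f g y = ∫ ξ, (F f : Rd d → ℂ) ξ * conj ((F g : Rd d → ℂ) ξ) *
      (fourierChar (inner ℝ y ξ) : ℂ) := by
  rw [pair_eq_inner hT, ← F.inner_map_map, fourier_trans hF hT, L2.inner_def]
  refine integral_congr_ae ?_
  filter_upwards [coeFn_modulation y (F g)] with ξ hξ
  rw [RCLike.inner_apply, hξ, map_mul, ← Circle.coe_inv_eq_conj, ← AddChar.map_neg_eq_inv, neg_neg,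
    mul_assoc]

end Fourier

section Coefficients

variable {d : ℕ} {P : Type*} {F : L2 d ≃ₗᵢ[ℂ] L2 d} {C : P → Matrix (Fin d) (Fin d) ℝ}
  {g h : P → L2 d}

/-- The point of the dual lattice of `C_p ℤ^d` with integer coordinates `m`. -/
def freq (C : P → Matrix (Fin d) (Fin d) ℝ) (q : P × (Fin d → ℤ)) : Rd d :=
  mApp ((C q.1)ᵀ)⁻¹ (zv q.2)

lemma freq_neg (C : P → Matrix (Fin d) (Fin d) ℝ) (p : P) (m : Fin d → ℤ) :
    freq C (p, -m) = -freq C (p, m) := by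
  have : (intVec (-m) : Fin d → ℝ) = -intVec m := by
    ext i
    simp [intVec]
  simp [freq, mApp_eq, zv_eq, this, Matrix.mulVec_neg]

/-- The points `ξ ∈ A` with `ξ + α ∈ B`. -/
def interShift (A B : Set (Rd d)) (α : Rd d) : Set (Rd d) := A ∩ (fun ξ => ξ + α) ⁻¹' B

lemma measurableSet_interShift {A B : Set (Rd d)} (hA : MeasurableSet A) (hB : MeasurableSet B)
    (α : Rd d) : MeasurableSet (interShift A B α) :=
  hA.inter (hB.preimage (measurable_add_const α))

lemma interShift_mono {A B A' B' : Set (Rd d)} (hA : A ⊆ A') (hB : B ⊆ B') (α : Rd d) :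
    interShift A B α ⊆ interShift A' B' α :=
  Set.inter_subset_inter hA (Set.preimage_mono hB)

/-- The summand of `alphaSum` attached to a point of a dual lattice. -/
def summand (F : L2 d ≃ₗᵢ[ℂ] L2 d) (C : P → Matrix (Fin d) (Fin d) ℝ) (g h : P → L2 d)
    (q : P × (Fin d → ℤ)) (ξ : Rd d) : ℂ :=
  ((|(C q.1).det|⁻¹ : ℝ) : ℂ) * conj ((F (g q.1) : Rd d → ℂ) ξ) *
    (F (h q.1) : Rd d → ℂ) (ξ + freq C q)

lemma aestronglyMeasurable_summand (q : P × (Fin d → ℤ)) :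
    AEStronglyMeasurable (summand F C g h q) volume := by
  unfold summand
  have h1 : AEStronglyMeasurable (fun ξ => (F (h q.1) : Rd d → ℂ) (ξ + freq C q)) volume :=
    (Lp.aestronglyMeasurable _).comp_measurePreserving (measurePreserving_add_right volume _)
  exact ((continuous_conj.comp_aestronglyMeasurable (Lp.aestronglyMeasurable _)).const_mul _).mul h1

/-- The element of `L²` with Fourier transform the indicator function of `A`. -/
def bandFun (F : L2 d ≃ₗᵢ[ℂ] L2 d) (A : Set (Rd d)) : L2 d :=
  if hA : MeasurableSet A ∧ volume A ≠ ⊤ then F.symm (indicatorConstLp 2 hA.1 hA.2 (1 : ℂ)) else 0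

lemma fourier_bandFun {A : Set (Rd d)} (hA : MeasurableSet A) (hA' : volume A ≠ ⊤) :
    F (bandFun F A) =ᵐ[volume] A.indicator fun _ => 1 := by
  rw [bandFun, dif_pos ⟨hA, hA'⟩, LinearIsometryEquiv.apply_symm_apply]
  exact indicatorConstLp_coeFn

lemma memD_bandFun {R : ℝ} : MemD F (bandFun F (Metric.closedBall (0 : Rd d) R)) := by
  have := fourier_bandFun (F := F) (A := Metric.closedBall (0 : Rd d) R)
    Metric.isClosed_closedBall.measurableSet measure_closedBall_lt_top.ne
  refine ⟨⟨1, ?_⟩, R, ?_⟩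
  · filter_upwards [this] with ξ hξ
    rw [hξ]
    exact (norm_indicator_le_norm_self _ _).trans (by simp)
  · filter_upwards [this] with ξ hξ h0
    rw [hξ] at h0
    simpa using Set.mem_of_indicator_ne_zero h0

lemma LocBound.tsum_setLIntegral_lt_top (hg : LocBound F C g) (R : ℝ) :
    ∑' q : P × (Fin d → ℤ),
      ∫⁻ ξ in interShift (Metric.closedBall 0 R) (Metric.closedBall 0 R) (freq C q),
        ENNReal.ofReal |(C q.1).det|⁻¹ * ‖(F (g q.1) : Rd d → ℂ) ξ‖ₑ ^ 2 < ⊤ := by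
  have hball : MeasurableSet (Metric.closedBall (0 : Rd d) R) :=
    Metric.isClosed_closedBall.measurableSet
  have hb := fourier_bandFun (F := F) hball measure_closedBall_lt_top.ne
  refine lt_of_le_of_lt ?_ (hg _ (memD_bandFun (R := R)))
  rw [ENNReal.tsum_prod']
  refine ENNReal.tsum_le_tsum fun p => ENNReal.tsum_le_tsum fun m => ?_
  have hshift := (quasiMeasurePreserving_add_right volume (freq C (p, m))).ae hb
  refine (setLIntegral_mono_ae' (measurableSet_interShift hball hball _)
    (g := fun ξ => (‖(F (bandFun F (Metric.closedBall (0 : Rd d) R)) : Rd d → ℂ)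
      (ξ + freq C (p, m))‖₊ : ℝ≥0∞) ^ 2 *
        ENNReal.ofReal |(C p).det|⁻¹ * (‖(F (g p) : Rd d → ℂ) ξ‖₊ : ℝ≥0∞) ^ 2) ?_).trans
    (lintegral_mono' (Measure.restrict_mono_ae ?_) le_rfl)
  · filter_upwards [hshift] with ξ hξ hmem
    rw [hξ, Set.indicator_of_mem (Set.mem_preimage.1 hmem.2)]
    simp [enorm_eq_nnnorm]
  · filter_upwards [hb] with ξ hξ hmem
    change _ ≠ _
    rw [hξ, Set.indicator_of_mem hmem.1]
    exact one_ne_zero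

lemma LocBound.tsum_setLIntegral_shift_lt_top (hh : LocBound F C h) (R : ℝ) :
    ∑' q : P × (Fin d → ℤ),
      ∫⁻ ξ in interShift (Metric.closedBall 0 R) (Metric.closedBall 0 R) (freq C q),
        ENNReal.ofReal |(C q.1).det|⁻¹ * ‖(F (h q.1) : Rd d → ℂ) (ξ + freq C q)‖ₑ ^ 2 < ⊤ := by
  have hball : MeasurableSet (Metric.closedBall (0 : Rd d) R) :=
    Metric.isClosed_closedBall.measurableSet
  refine lt_of_eq_of_lt ?_ (hh.tsum_setLIntegral_lt_top R)
  rw [← ((Equiv.refl P).prodCongr (Equiv.neg (Fin d → ℤ))).tsum_eq]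
  refine tsum_congr fun q => ?_
  have hq : freq C (((Equiv.refl P).prodCongr (Equiv.neg (Fin d → ℤ))) q) = -freq C q :=
    freq_neg C q.1 q.2
  rw [hq, ← lintegral_indicator (measurableSet_interShift hball hball _),
    ← lintegral_indicator (measurableSet_interShift hball hball _),
    ← lintegral_add_right_eq_self _ (freq C q)]
  congr 1
  ext ξ
  simp only [Set.indicator_apply, interShift, Set.mem_inter_iff, Set.mem_preimage,
    add_neg_cancel_right]
  simp [and_comm]

lemma tsum_setLIntegral_summand_lt_top (hg : LocBound F C g) (hh : LocBound F C h) (R : ℝ) :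
    ∑' q : P × (Fin d → ℤ),
      ∫⁻ ξ in interShift (Metric.closedBall 0 R) (Metric.closedBall 0 R) (freq C q),
        ‖summand F C g h q ξ‖ₑ < ⊤ := by
  refine lt_of_le_of_lt ?_ (ENNReal.add_lt_top.2
    ⟨hg.tsum_setLIntegral_lt_top R, hh.tsum_setLIntegral_shift_lt_top R⟩)
  rw [← ENNReal.tsum_add]
  refine ENNReal.tsum_le_tsum fun q => ?_
  rw [← lintegral_add_left']
  · refine lintegral_mono fun ξ => ?_
    have key : ∀ a b : ℝ≥0∞, a * b ≤ a ^ 2 + b ^ 2 := fun a b => by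
      rcases le_total a b with hab | hab
      · exact (mul_le_mul_left hab b).trans (by rw [← sq]; exact le_add_self)
      · exact (mul_le_mul_right hab a).trans (by rw [← sq]; exact le_self_add)
    rw [← mul_add, summand, enorm_mul, enorm_mul, mul_assoc, RCLike.enorm_conj]
    refine mul_le_mul' (le_of_eq ?_) (key _ _)
    rw [← ofReal_norm, Complex.norm_real, Real.norm_of_nonneg (by positivity)]
  · exact (((Lp.aestronglyMeasurable _).enorm.pow_const 2).const_mul _).restrict

end Coefficients

section Formula

variable {d : ℕ} {P : Type*} {F : L2 d ≃ₗᵢ[ℂ] L2 d} {C : P → Matrix (Fin d) (Fin d) ℝ}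
  {g h : P → L2 d} {T : Rd d → L2 d → L2 d} {A B : Set (Rd d)} {R : ℝ}

lemma volume_ne_top_of_subset_closedBall (hAR : A ⊆ Metric.closedBall 0 R) : volume A ≠ ⊤ :=
  ((measure_mono hAR).trans_lt measure_closedBall_lt_top).ne

lemma fourier_trans_bandFun (hF : IsFourier F) (hT : IsTrans T) (hA : MeasurableSet A)
    (hAR : A ⊆ Metric.closedBall 0 R) (x : Rd d) :
    F (T x (bandFun F A)) =ᵐ[volume]
      fun ξ => A.indicator 1 ξ * (fourierChar (-inner ℝ x ξ) : ℂ) := by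
  rw [fourier_trans hF hT]
  filter_upwards [coeFn_modulation x (F (bandFun F A)),
    fourier_bandFun (F := F) hA (volume_ne_top_of_subset_closedBall hAR)] with ξ h1 h2
  rw [h1, h2]
  rfl

/-- The restriction of the conjugate of `u` to `A`, modulated by `x`. -/
def localized (A : Set (Rd d)) (x : Rd d) (u : L2 d) (ξ : Rd d) : ℂ :=
  A.indicator (fun ξ => conj ((u : Rd d → ℂ) ξ)) ξ * (fourierChar (-inner ℝ x ξ) : ℂ)

lemma memLp_localized (hA : MeasurableSet A) (x : Rd d) (u : L2 d) :
    MemLp (localized A x u) 2 :=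
  ((Lp.memLp u).star.indicator hA).mul_circle (c := fun ξ => fourierChar (-inner ℝ x ξ))
    (Real.continuous_fourierChar.comp (by fun_prop))

lemma localized_eq_zero (hAR : A ⊆ Metric.closedBall 0 R) (x : Rd d) (u : L2 d) (ξ : Rd d)
    (hξ : R < ‖ξ‖) : localized A x u ξ = 0 := by
  have : ξ ∉ A := fun h => by
    have := hAR h
    rw [mem_closedBall_zero_iff] at this
    linarith
  simp [localized, this]

lemma integrable_localized (hA : MeasurableSet A) (hAR : A ⊆ Metric.closedBall 0 R) (x : Rd d)
    (u : L2 d) : Integrable (localized A x u) := by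
  have hball : MeasurableSet (Metric.closedBall (0 : Rd d) R) :=
    Metric.isClosed_closedBall.measurableSet
  have hs : (Metric.closedBall (0 : Rd d) R).indicator (localized A x u) = localized A x u := by
    refine Set.indicator_eq_self.2 fun ξ hξ => ?_
    by_contra hn
    rw [mem_closedBall_zero_iff, not_le] at hn
    exact hξ (localized_eq_zero hAR x u ξ hn)
  rw [← hs, integrable_indicator_iff hball]
  have : IsFiniteMeasure (volume.restrict (Metric.closedBall (0 : Rd d) R)) :=
    ⟨by simpa using measure_closedBall_lt_top⟩
  exact ((memLp_localized hA x u).restrict _).integrable one_le_two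

lemma pair_trans_bandFun (hF : IsFourier F) (hT : IsTrans T) (hA : MeasurableSet A)
    (hAR : A ⊆ Metric.closedBall 0 R) (x y : Rd d) (u : L2 d) :
    pair (T x (bandFun F A)) u y =
      ∫ ξ, localized A x (F u) ξ * (fourierChar (inner ℝ y ξ) : ℂ) := by
  rw [pair_eq_integral hF hT]
  refine integral_congr_ae ?_
  filter_upwards [fourier_trans_bandFun hF hT hA hAR x] with ξ hξ
  rw [hξ, localized]
  by_cases hm : ξ ∈ A
  · simp only [Set.indicator_of_mem hm, Pi.one_apply]
    ring
  · simp [hm]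

lemma integral_localized_mul (hA : MeasurableSet A) (hB : MeasurableSet B) (x : Rd d)
    (q : P × (Fin d → ℤ)) :
    ((|(C q.1).det|⁻¹ : ℝ) : ℂ) * ∫ ξ, localized A x (F (g q.1)) ξ *
        conj (localized B x (F (h q.1)) (ξ + freq C q)) =
      (∫ ξ in interShift A B (freq C q), summand F C g h q ξ) *
        (fourierChar (inner ℝ (freq C q) x) : ℂ) := by
  rw [← integral_indicator (measurableSet_interShift hA hB _), ← integral_const_mul,
    ← integral_mul_const]
  congr 1
  ext ξ
  by_cases h1 : ξ ∈ A
  · by_cases h2 : ξ + freq C q ∈ B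
    · rw [Set.indicator_of_mem (show ξ ∈ interShift A B (freq C q) from ⟨h1, h2⟩), localized,
        localized, Set.indicator_of_mem h1, Set.indicator_of_mem h2, map_mul, Complex.conj_conj,
        ← Circle.coe_inv_eq_conj, ← AddChar.map_neg_eq_inv, neg_neg, inner_add_right,
        AddChar.map_add_eq_mul, Circle.coe_mul, AddChar.map_neg_eq_inv, Circle.coe_inv,
        real_inner_comm x (freq C q), summand]
      field_simp [Circle.coe_ne_zero]
    · have : ξ ∉ interShift A B (freq C q) := fun h => h2 h.2
      simp [localized, h2, this]
  · have : ξ ∉ interShift A B (freq C q) := fun h => h1 h.1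
    simp [localized, h1, this]

lemma exists_hasSum_fiber (hF : IsFourier F) (hT : IsTrans T) (hC : ∀ p, IsUnit (C p).det)
    (hA : MeasurableSet A) (hB : MeasurableSet B)
    (hAR : A ⊆ Metric.closedBall 0 R) (hBR : B ⊆ Metric.closedBall 0 R) (x : Rd d) (p : P) :
    ∃ S : ℂ, HasSum (fun k : Fin d → ℤ =>
      pair (T x (bandFun F A)) (g p) (mApp (C p) (zv k)) *
        inner ℂ (T x (bandFun F B)) (T (mApp (C p) (zv k)) (h p))) S ∧
      HasSum (fun m : Fin d → ℤ =>
        (∫ ξ in interShift A B (freq C (p, m)), summand F C g h (p, m) ξ) *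
          (fourierChar (inner ℝ (freq C (p, m)) x) : ℂ)) S := by
  obtain ⟨S, h1, h2⟩ := exists_hasSum_lattice (hC p) (memLp_localized hA x (F (g p)))
    (memLp_localized hB x (F (h p))) (integrable_localized hA hAR x _)
    (integrable_localized hB hBR x _) (localized_eq_zero hAR x _) (localized_eq_zero hBR x _)
  refine ⟨S, h1.congr_fun fun k => ?_, h2.congr_fun fun m => ?_⟩
  · rw [← pair_trans_bandFun hF hT hA hAR, ← pair_trans_bandFun hF hT hB hBR, pair_eq_inner hT
      (T x (bandFun F B)), inner_conj_symm]
  · exact (integral_localized_mul hA hB x (p, m)).symm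

lemma integrableOn_summand_of_lt_top (hg : LocBound F C g) (hh : LocBound F C h)
    (R : ℝ) (q : P × (Fin d → ℤ)) :
    IntegrableOn (summand F C g h q)
      (interShift (Metric.closedBall 0 R) (Metric.closedBall 0 R) (freq C q)) :=
  ⟨(aestronglyMeasurable_summand q).restrict,
    (ENNReal.le_tsum q).trans_lt (tsum_setLIntegral_summand_lt_top hg hh R)⟩

lemma summable_integral_norm_summand (hg : LocBound F C g) (hh : LocBound F C h)
    (hAR : A ⊆ Metric.closedBall 0 R) (hBR : B ⊆ Metric.closedBall 0 R) :
    Summable fun q : P × (Fin d → ℤ) =>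
      ∫ ξ in interShift A B (freq C q), ‖summand F C g h q ξ‖ := by
  have := ENNReal.summable_toReal (tsum_setLIntegral_summand_lt_top hg hh R).ne
  refine Summable.of_nonneg_of_le (fun q => by positivity) (fun q => ?_) this
  rw [integral_norm_eq_lintegral_enorm (aestronglyMeasurable_summand q).restrict]
  refine ENNReal.toReal_mono (integrableOn_summand_of_lt_top hg hh R q).2.ne ?_
  exact lintegral_mono_set (interShift_mono hAR hBR _)

lemma summable_norm_coeff (hg : LocBound F C g) (hh : LocBound F C h)
    (hAR : A ⊆ Metric.closedBall 0 R) (hBR : B ⊆ Metric.closedBall 0 R) :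
    Summable fun q : P × (Fin d → ℤ) =>
      ‖∫ ξ in interShift A B (freq C q), summand F C g h q ξ‖ :=
  Summable.of_nonneg_of_le (fun _ => norm_nonneg _) (fun _ => norm_integral_le_integral_norm _)
    (summable_integral_norm_summand hg hh hAR hBR)

/-- The matrix coefficients of `Ω` against translates of band functions, as an absolutely
convergent generalized Fourier series. -/
lemma hasSum_inner_omega (hF : IsFourier F) (hT : IsTrans T)
    (hC : ∀ p, IsUnit (C p).det) (hg : LocBound F C g) (hh : LocBound F C h)
    {Ω : L2 d → L2 d} (hΩ : IsOmega T C C g h Ω)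
    (hA : MeasurableSet A) (hB : MeasurableSet B)
    (hAR : A ⊆ Metric.closedBall 0 R) (hBR : B ⊆ Metric.closedBall 0 R) (x : Rd d) :
    HasSum (fun q : P × (Fin d → ℤ) =>
      (∫ ξ in interShift A B (freq C q), summand F C g h q ξ) *
        (fourierChar (inner ℝ (freq C q) x) : ℂ))
      (inner ℂ (T x (bandFun F B)) (Ω (T x (bandFun F A)))) := by
  have hs : Summable (fun q : P × (Fin d → ℤ) =>
      (∫ ξ in interShift A B (freq C q), summand F C g h q ξ) *
        (fourierChar (inner ℝ (freq C q) x) : ℂ)) := by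
    refine Summable.of_norm ?_
    simpa only [norm_mul, Circle.norm_coe, mul_one] using summable_norm_coeff hg hh hAR hBR
  have h1 := (hΩ (T x (bandFun F A))).mapL (innerSL ℂ (T x (bandFun F B)))
  simp only [map_smul, innerSL_apply_apply, smul_eq_mul] at h1
  choose S hS1 hS2 using exists_hasSum_fiber (g := g) (h := h) hF hT hC hA hB hAR hBR x
  have h2 := h1.prod_fiberwise hS1
  have h3 := hs.hasSum.prod_fiberwise hS2
  rw [h2.unique h3]
  exact hs.hasSum

end Formula

lemma integrable_tsum_of_tsum_lintegral_ne_top {ι X : Type*} [Countable ι] [MeasurableSpace X]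
    {μ : Measure X} {f : ι → X → ℂ} (hf : ∀ i, AEStronglyMeasurable (f i) μ)
    (h : ∑' i, ∫⁻ a, ‖f i a‖ₑ ∂μ ≠ ⊤) : Integrable (fun a => ∑' i, f i a) μ := by
  rw [← lintegral_tsum fun i => (hf i).enorm] at h
  refine ⟨?_, (lintegral_mono fun a => enorm_tsum_le_tsum_enorm).trans_lt h.lt_top⟩
  refine aestronglyMeasurable_of_tendsto_ae (Filter.atTop : Filter (Finset ι))
    (f := fun s a => ∑ i ∈ s, f i a)
    (fun s => Finset.aestronglyMeasurable_fun_sum s fun i _ => hf i) ?_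
  filter_upwards [ae_lt_top' (AEMeasurable.tsum fun i => (hf i).enorm) h] with a ha
  have : Summable fun i => f i a := by
    refine Summable.of_nnnorm ?_
    rw [← ENNReal.tsum_coe_ne_top_iff_summable]
    exact ha.ne
  exact this.hasSum

/-- A locally integrable function on `ℝ^d` all of whose integrals over bounded sets vanish is
almost everywhere zero. -/
lemma ae_eq_zero_of_setIntegral_bounded {d : ℕ} {f : Rd d → ℂ}
    (hf : ∀ R : ℝ, IntegrableOn f (Metric.closedBall 0 R))
    (h0 : ∀ R : ℝ, ∀ A ⊆ Metric.closedBall (0 : Rd d) R, MeasurableSet A → ∫ ξ in A, f ξ = 0) :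
    ∀ᵐ ξ, f ξ = 0 := by
  have hball : ∀ R : ℝ, MeasurableSet (Metric.closedBall (0 : Rd d) R) :=
    fun R => Metric.isClosed_closedBall.measurableSet
  have key : ∀ n : ℕ, ∀ᵐ ξ, (Metric.closedBall (0 : Rd d) n).indicator f ξ = 0 := fun n =>
    ((integrable_indicator_iff (hball n)).2 (hf n)).ae_eq_zero_of_forall_setIntegral_eq_zero
      fun s hs _ => by
        rw [setIntegral_indicator (hball n)]
        exact h0 n _ Set.inter_subset_right (hs.inter (hball n))
  filter_upwards [ae_all_iff.2 key] with ξ hξ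
  obtain ⟨n, hn⟩ := exists_nat_ge ‖ξ‖
  rw [← hξ n, Set.indicator_of_mem (mem_closedBall_zero_iff.2 hn)]

section Fibers

variable {d : ℕ} {P : Type*} {F : L2 d ≃ₗᵢ[ℂ] L2 d} {C : P → Matrix (Fin d) (Fin d) ℝ}
  {g h : P → L2 d} {T : Rd d → L2 d → L2 d} {A B : Set (Rd d)} {R : ℝ}

lemma mApp_eq_zv_iff (hC : ∀ p, IsUnit (C p).det) (q : P × (Fin d → ℤ)) (α : Rd d) :
    mApp (C q.1)ᵀ α = zv q.2 ↔ freq C q = α := by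
  have hu : IsUnit ((C q.1)ᵀ).det := by
    rw [Matrix.det_transpose]
    exact hC q.1
  have h1 : ∀ x, mApp ((C q.1)ᵀ)⁻¹ (mApp (C q.1)ᵀ x) = x := fun x => by
    simp [mApp_eq, Matrix.nonsing_inv_mul _ hu]
  have h2 : ∀ x, mApp (C q.1)ᵀ (mApp ((C q.1)ᵀ)⁻¹ x) = x := fun x => by
    simp [mApp_eq, Matrix.mul_nonsing_inv _ hu]
  constructor
  · intro h
    rw [freq, ← h, h1]
  · rintro rfl
    rw [freq, h2]

lemma zv_injective : Function.Injective (zv : (Fin d → ℤ) → Rd d) := by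
  intro a b hab
  ext i
  have := congrFun (congrArg (EuclideanSpace.equiv (Fin d) ℝ) hab) i
  simpa [zv] using this

/-- `P_α` parametrizes the dual lattice points equal to `α`. -/
def fiberEquiv (hC : ∀ p, IsUnit (C p).det) (α : Rd d) :
    {q : P × (Fin d → ℤ) // freq C q = α} ≃ {p : P // memPalpha C α p} :=
  Equiv.ofBijective (fun q => ⟨q.1.1, q.1.2, (mApp_eq_zv_iff hC _ _).2 q.2⟩) (by
    constructor
    · rintro ⟨⟨p, m⟩, hq⟩ ⟨⟨p', m'⟩, hq'⟩ hpp
      obtain rfl : p = p' := congrArg Subtype.val hpp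
      rw [← mApp_eq_zv_iff hC] at hq hq'
      obtain rfl := zv_injective (hq.symm.trans hq')
      rfl
    · rintro ⟨p, m, hm⟩
      exact ⟨⟨(p, m), (mApp_eq_zv_iff hC (p, m) α).1 hm⟩, rfl⟩)

lemma alphaSum_eq_tsum (hC : ∀ p, IsUnit (C p).det) (α ξ : Rd d) :
    alphaSum F C g h α ξ = ∑' q : {q : P × (Fin d → ℤ) // freq C q = α}, summand F C g h q ξ := by
  rw [alphaSum, ← (fiberEquiv hC α).tsum_eq]
  refine tsum_congr fun q => ?_
  rw [summand, q.2]
  rfl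

variable [Countable P]

lemma integrableOn_alphaSum (hC : ∀ p, IsUnit (C p).det) (hg : LocBound F C g)
    (hh : LocBound F C h) (α : Rd d) (R : ℝ) :
    IntegrableOn (alphaSum F C g h α)
      (interShift (Metric.closedBall 0 R) (Metric.closedBall 0 R) α) := by
  rw [funext (alphaSum_eq_tsum (F := F) (g := g) (h := h) hC α)]
  refine integrable_tsum_of_tsum_lintegral_ne_top
    (fun q => (aestronglyMeasurable_summand q.1).restrict) (ne_of_lt ?_)
  refine lt_of_le_of_lt ?_ (tsum_setLIntegral_summand_lt_top hg hh R)
  refine le_trans (le_of_eq ?_) (ENNReal.tsum_comp_le_tsum_of_injective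
    (Subtype.val_injective (p := fun q => freq C q = α)) _)
  exact tsum_congr fun q => by rw [q.2]

lemma tsum_coeff_fiber (hC : ∀ p, IsUnit (C p).det) (hg : LocBound F C g) (hh : LocBound F C h)
    (hAR : A ⊆ Metric.closedBall 0 R) (hBR : B ⊆ Metric.closedBall 0 R) (α : Rd d) :
    ∑' q : {q : P × (Fin d → ℤ) // freq C q = α},
      ∫ ξ in interShift A B (freq C q), summand F C g h q ξ =
        ∫ ξ in interShift A B α, alphaSum F C g h α ξ := by
  have hint : ∀ q : {q : P × (Fin d → ℤ) // freq C q = α},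
      IntegrableOn (summand F C g h q) (interShift A B α) := fun q => by
    have := integrableOn_summand_of_lt_top hg hh R q.1
    rw [q.2] at this
    exact this.mono_set (interShift_mono hAR hBR _)
  have hsum : Summable fun q : {q : P × (Fin d → ℤ) // freq C q = α} =>
      ∫ ξ in interShift A B α, ‖summand F C g h q ξ‖ := by
    refine ((summable_integral_norm_summand hg hh hAR hBR).comp_injective
      (Subtype.val_injective (p := fun q => freq C q = α))).congr fun q => ?_
    rw [Function.comp_apply, q.2]
  simp_rw [alphaSum_eq_tsum (F := F) (g := g) (h := h) hC α]
  rw [← (hasSum_integral_of_summable_integral_norm (μ := volume.restrict (interShift A B α))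
    (F := fun (q : {q : P × (Fin d → ℤ) // freq C q = α}) ξ => summand F C g h q ξ)
    hint hsum).tsum_eq]
  exact tsum_congr fun q => by rw [q.2]

end Fibers

section Main

variable {d : ℕ} {P : Type*} {F : L2 d ≃ₗᵢ[ℂ] L2 d} {C : P → Matrix (Fin d) (Fin d) ℝ}
  {g h : P → L2 d} {T : Rd d → L2 d → L2 d} {Ω : L2 d → L2 d}

lemma eq_zero_of_inner_bandFun {u : L2 d}
    (hu : ∀ R : ℝ, ∀ A ⊆ Metric.closedBall (0 : Rd d) R, MeasurableSet A →
      inner ℂ (bandFun F A) u = 0) : u = 0 := by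
  have : ∀ᵐ ξ, (F u : Rd d → ℂ) ξ = 0 := by
    refine ae_eq_zero_of_setIntegral_bounded (fun R => ?_) fun R A hAR hA => ?_
    · have : IsFiniteMeasure (volume.restrict (Metric.closedBall (0 : Rd d) R)) :=
        ⟨by simpa using measure_closedBall_lt_top⟩
      exact ((Lp.memLp (F u)).restrict _).integrable one_le_two
    · have hA' := volume_ne_top_of_subset_closedBall hAR
      rw [← L2.inner_indicatorConstLp_one (𝕜 := ℂ) hA hA', ← hu R A hAR hA,
        ← F.inner_map_map (bandFun F A), bandFun, dif_pos ⟨hA, hA'⟩, LinearIsometryEquiv.apply_symm_apply]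
  rw [← F.map_eq_zero_iff]
  exact (Lp.eq_zero_iff_ae_eq_zero).2 this

lemma trans_zero (hT : IsTrans T) (f : L2 d) : T 0 f = f :=
  Lp.ext ((hT 0 f).trans (by simp))

variable [Countable P]

/-- The operator `Ω` is linear and continuous. -/
lemma IsOmega.exists_continuousLinearMap {D : P → Matrix (Fin d) (Fin d) ℝ} (hT : IsTrans T)
    (hΩ : IsOmega T C D g h Ω) : ∃ L : L2 d →L[ℂ] L2 d, ∀ f, L f = Ω f := by
  refine ⟨continuousLinearMapOfTendsto (l := (Filter.atTop : Filter (Finset (P × (Fin d → ℤ)))))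
    (fun s => ∑ q ∈ s, (innerSL ℂ (T (mApp (C q.1) (zv q.2)) (g q.1))).smulRight
      (T (mApp (D q.1) (zv q.2)) (h q.1))) (f := Ω) ?_, fun f => rfl⟩
  refine tendsto_pi_nhds.2 fun f => ?_
  have := hΩ f
  simp_rw [pair_eq_inner hT] at this
  simpa [HasSum] using this

lemma alphaSum_ae_eq_zero (hF : IsFourier F) (hT : IsTrans T)
    (hC : ∀ p, IsUnit (C p).det) (hg : LocBound F C g) (hh : LocBound F C h)
    (hΩ : IsOmega T C C g h Ω) (h0 : ∀ f, Ω f = 0) (α : Rd d) :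
    ∀ᵐ ξ, alphaSum F C g h α ξ = 0 := by
  have hsub : ∀ R : ℝ, ∀ A ⊆ Metric.closedBall (0 : Rd d) R,
      A ⊆ Metric.closedBall (0 : Rd d) (R + ‖α‖) ∧
        interShift A (Metric.closedBall 0 (R + ‖α‖)) α = A := by
    refine fun R A hA => ⟨hA.trans (Metric.closedBall_subset_closedBall (by simp)),
      Set.inter_eq_left.2 fun ξ hξ => ?_⟩
    have h1 := mem_closedBall_zero_iff.1 (hA hξ)
    exact mem_closedBall_zero_iff.2 ((norm_add_le _ _).trans (by gcongr))
  refine ae_eq_zero_of_setIntegral_bounded (fun R => ?_) fun R A hAR hA => ?_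
  · have h1 := integrableOn_alphaSum hC hg hh α (R + ‖α‖)
    have h2 := hsub R _ subset_rfl
    exact h1.mono_set (h2.2.symm.subset.trans (interShift_mono h2.1 subset_rfl α))
  · obtain ⟨h1, h2⟩ := hsub R A hAR
    have h3 := tsum_coeff_eq_zero (summable_norm_coeff hg hh h1 subset_rfl) (α := freq C)
      (fun x => by
        have := hasSum_inner_omega hF hT hC hg hh hΩ hA
          Metric.isClosed_closedBall.measurableSet h1 subset_rfl x
        rw [h0, inner_zero_right] at this
        exact this.tsum_eq) α
    rwa [tsum_coeff_fiber hC hg hh h1 subset_rfl, h2] at h3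

lemma omega_eq_zero_of_alphaSum (hF : IsFourier F) (hT : IsTrans T)
    (hC : ∀ p, IsUnit (C p).det) (hg : LocBound F C g) (hh : LocBound F C h)
    (hΩ : IsOmega T C C g h Ω)
    (h0 : ∀ α, memLambda C α → ∀ᵐ ξ, alphaSum F C g h α ξ = 0) (f : L2 d) : Ω f = 0 := by
  obtain ⟨L, hL⟩ := hΩ.exists_continuousLinearMap hT
  have hband : ∀ (R : ℝ), ∀ A ⊆ Metric.closedBall (0 : Rd d) R, MeasurableSet A →
      Ω (bandFun F A) = 0 := by
    refine fun R A hAR hA => eq_zero_of_inner_bandFun (F := F) fun R' B hBR hB => ?_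
    replace hAR := hAR.trans (Metric.closedBall_subset_closedBall (le_max_left R R'))
    replace hBR := hBR.trans (Metric.closedBall_subset_closedBall (le_max_right R R'))
    have h1 := hasSum_inner_omega hF hT hC hg hh hΩ hA hB hAR hBR 0
    simp only [trans_zero hT, inner_zero_right, AddChar.map_zero_eq_one, Circle.coe_one,
      mul_one] at h1
    rw [← h1.tsum_eq, ← (Equiv.sigmaFiberEquiv (freq C)).tsum_eq]
    refine ((Equiv.sigmaFiberEquiv (freq C)).summable_iff.2 h1.summable).tsum_sigma.trans ?_
    refine (tsum_congr fun α => ?_).trans tsum_zero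
    refine (tsum_coeff_fiber hC hg hh hAR hBR α).trans ?_
    by_cases hα : memLambda C α
    · exact integral_eq_zero_of_ae (ae_restrict_of_ae (h0 α hα))
    · have : IsEmpty {q : P × (Fin d → ℤ) // freq C q = α} :=
        ⟨fun q => hα ⟨q.1.1, q.1.2, q.2.symm⟩⟩
      simp [alphaSum_eq_tsum hC]
  rw [← hL]
  refine ext_inner_right ℂ fun w => ?_
  rw [← ContinuousLinearMap.adjoint_inner_right, eq_zero_of_inner_bandFun (F := F)
    (u := L.adjoint w) fun R A hAR hA => ?_, inner_zero_right, inner_zero_left]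
  rw [ContinuousLinearMap.adjoint_inner_right, hL, hband R A hAR hA, inner_zero_left]

end Main

/-- Lemma 5 of the paper. With `G = {T_{C_p k} g_p}` and
`H = {T_{C_p k} h_p}` Bessel and locally bounded, and `Ω = Ω_{H,G}` as in Lemma 1,
one has `Ω = 0` iff for all `α ∈ Λ` (including `α = 0`),
`Σ_{p ∈ P_α} |det C_p|⁻¹ conj(ĝ_p(ξ)) ĥ_p(ξ+α) = 0` a.e. `ξ`. -/
theorem omega_eq_zero_iff {d : ℕ} (hd : 1 ≤ d) {P : Type} [Countable P]
    (F : L2 d ≃ₗᵢ[ℂ] L2 d) (hF : IsFourier F)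
    (C : P → Matrix (Fin d) (Fin d) ℝ) (hC : ∀ p, IsUnit (C p).det)
    (g h : P → L2 d)
    (hGb : Bessel C g) (hHb : Bessel C h)
    (hGl : LocBound F C g) (hHl : LocBound F C h)
    (T : Rd d → L2 d → L2 d) (hT : IsTrans T)
    (Ω : L2 d → L2 d) (hΩ : IsOmega T C C g h Ω) :
    (∀ f : L2 d, Ω f = 0) ↔
      ∀ α : Rd d, memLambda C α →
        ∀ᵐ ξ ∂(volume : Measure (Rd d)), alphaSum F C g h α ξ = 0 :=
  ⟨fun h0 α _ => alphaSum_ae_eq_zero hF hT hC hGl hHl hΩ h0 α,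
    fun h0 f => omega_eq_zero_of_alphaSum hF hT hC hGl hHl hΩ h0 f⟩

end GSL
end
end

section
/- Let E ⊆ ℝ^d be a band and A an invertible real d×d matrix such that Σ_{m∈ℤ^d} χ_E(A^{*-1}(ξ + m)) ≤ 1 for a.e. ξ ∈ ℝ^d. Then for every f ∈ V_E, Σ_{z∈ℤ^d} |f(Az)|² = |det A|^{-1} ‖f‖²; that is, the samples {Az : z ∈ ℤ^d} are tight on E with constant |det A|^{-1}. -/
open MeasureTheory Complex Matrix
open scoped FourierTransform ENNReal NNReal RealInnerProductSpace Classical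

noncomputable section

namespace GSL

/-- The half-open unit cube `(0,1]^ι`, a fundamental domain for `ℤ^ι` acting on `ℝ^ι`. -/
def unitCube (ι : Type*) : Set (ι → ℝ) := {x | ∀ i, x i ∈ Set.Ioc (0 : ℝ) (0 + 1)}

lemma measurableSet_unitCube {ι : Type*} [Fintype ι] : MeasurableSet (unitCube ι) :=
  MeasurableSet.univ_pi' fun _ => measurableSet_Ioc

/-- The character `x ↦ e^{-2πi n·x}` of `ℝ^ι` attached to `n ∈ ℤ^ι`. -/
def latticeChar {ι : Type*} [Fintype ι] (n : ι → ℤ) (x : ι → ℝ) : ℂ :=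
  Complex.exp (((-(2 * Real.pi * ∑ i, (n i : ℝ) * x i) : ℝ) : ℂ) * Complex.I)

lemma norm_latticeChar {ι : Type*} [Fintype ι] (n : ι → ℤ) (x : ι → ℝ) :
    ‖latticeChar n x‖ = 1 :=
  Complex.norm_exp_ofReal_mul_I _

@[fun_prop]
lemma continuous_latticeChar {ι : Type*} [Fintype ι] (n : ι → ℤ) :
    Continuous (latticeChar n) := by
  unfold latticeChar
  fun_prop

lemma mFourier_neg_coe {ι : Type*} [Fintype ι] (n : ι → ℤ) (x : ι → ℝ) :
    UnitAddTorus.mFourier (-n) (fun i => (x i : UnitAddCircle)) = latticeChar n x := by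
  simp only [UnitAddTorus.mFourier, ContinuousMap.coe_mk, fourier_coe_apply, latticeChar]
  rw [← Complex.exp_sum]
  congr 1
  push_cast
  simp only [Finset.mul_sum, Finset.sum_mul, ← Finset.sum_neg_distrib, Pi.neg_apply]
  refine Finset.sum_congr rfl fun i _ => ?_
  push_cast
  ring

lemma latticeChar_add_int {ι : Type*} [Fintype ι] (n m : ι → ℤ) (x : ι → ℝ) :
    latticeChar n (x + fun i => (m i : ℝ)) = latticeChar n x := by
  rw [← mFourier_neg_coe, ← mFourier_neg_coe]
  congr 1
  ext i
  simp

/-- Parseval's identity on the unit cube. -/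
lemma tsum_enorm_sq_setIntegral_latticeChar {ι : Type*} [Fintype ι] (G : (ι → ℝ) → ℂ)
    (hG : MemLp G 2 (volume.restrict (unitCube ι))) :
    ∑' n : ι → ℤ, ‖∫ x in unitCube ι, latticeChar n x * G x‖ₑ ^ 2 =
      ∫⁻ x in unitCube ι, ‖G x‖ₑ ^ 2 := by
  let _ := instMeasureSpaceUnitAddCircle
  let e := UnitAddTorus.measurableEquivPiIoc (0 : ι → ℝ)
  let p : UnitAddTorus ι → (ι → ℝ) := fun t => (e t).1
  have hp : MeasurePreserving p volume (volume.restrict (unitCube ι)) :=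
    (measurePreserving_subtype_coe measurableSet_unitCube).comp
      (UnitAddTorus.measurePreserving_equivPiIoc (0 : ι → ℝ))
  have hpx : ∀ x ∈ unitCube ι, p (fun i => (x i : UnitAddCircle)) = x := fun x hx =>
    congrArg Subtype.val (e.apply_symm_apply ⟨x, hx⟩)
  have hg : MemLp (G ∘ p) 2 volume := hG.comp_measurePreserving hp
  have hcoeff : ∀ n, UnitAddTorus.mFourierCoeff (hg.toLp (G ∘ p)) n =
      ∫ x in unitCube ι, latticeChar n x * G x := fun n => by
    calc _ = UnitAddTorus.mFourierCoeff (G ∘ p) n := by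
          refine integral_congr_ae ?_
          filter_upwards [hg.coeFn_toLp] with t ht
          rw [ht]
      _ = _ := by
          rw [UnitAddTorus.mFourierCoeff_eq_integral _ n 0]
          refine setIntegral_congr_fun measurableSet_unitCube fun x hx => ?_
          simp only [mFourier_neg_coe, Function.comp_apply, smul_eq_mul]
          rw [hpx x hx]
  have hs := UnitAddTorus.hasSum_sq_mFourierCoeff (hg.toLp (G ∘ p))
  have h1 : ∑' n : ι → ℤ, ‖∫ x in unitCube ι, latticeChar n x * G x‖ₑ ^ 2 =
      ENNReal.ofReal (∫ t, ‖(hg.toLp (G ∘ p)) t‖ ^ 2) := by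
    rw [← hs.tsum_eq, ENNReal.ofReal_tsum_of_nonneg (fun _ => by positivity) hs.summable]
    refine tsum_congr fun n => ?_
    rw [hcoeff, ENNReal.ofReal_pow (norm_nonneg _), ofReal_norm]
  have h2 : ENNReal.ofReal (∫ t, ‖(hg.toLp (G ∘ p)) t‖ ^ 2) = ∫⁻ t, ‖(G ∘ p) t‖ₑ ^ 2 := by
    rw [ofReal_integral_eq_lintegral_ofReal]
    · refine lintegral_congr_ae ?_
      filter_upwards [hg.coeFn_toLp] with t ht
      rw [ht, ENNReal.ofReal_pow (norm_nonneg _), ofReal_norm]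
    · exact (Lp.memLp _).integrable_norm_pow (by simp)
    · exact Filter.Eventually.of_forall fun _ => by positivity
  rw [h1, h2, UnitAddTorus.lintegral_preimage _ (0 : ι → ℝ)]
  refine setLIntegral_congr_fun measurableSet_unitCube fun x hx => ?_
  simp only [Function.comp_apply]
  rw [hpx x hx]

/-- Lebesgue measure is the sum of the integer translates of its restriction to the unit cube. -/
lemma volume_eq_sum_map_unitCube (ι : Type*) [Fintype ι] :
    (volume : Measure (ι → ℝ)) = Measure.sum fun m : ι → ℤ =>
      (volume.restrict (unitCube ι)).map (· + fun i => (m i : ℝ)) := by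
  have hmap : ∀ m : ι → ℤ, (volume.restrict (unitCube ι)).map (· + fun i => (m i : ℝ)) =
      volume.restrict ((· - fun i => (m i : ℝ)) ⁻¹' unitCube ι) := fun m => by
    have h := ((measurePreserving_add_right (volume : Measure (ι → ℝ))
      (fun i => (m i : ℝ))).restrict_preimage
      (s := (· - fun i => (m i : ℝ)) ⁻¹' unitCube ι)
      ((measurable_sub_const _) measurableSet_unitCube)).map_eq
    rw [← h]
    congr 2
    ext x
    simp
  simp_rw [hmap]
  rw [← Measure.restrict_iUnion]
  · rw [show (⋃ m : ι → ℤ, (· - fun i => (m i : ℝ)) ⁻¹' unitCube ι) = Set.univ from ?_,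
      Measure.restrict_univ]
    refine Set.eq_univ_of_forall fun x => Set.mem_iUnion.2 ⟨fun i => ⌈x i⌉ - 1, fun i => ?_⟩
    have h1 := Int.le_ceil (x i)
    have h2 := Int.ceil_lt_add_one (x i)
    simp only [Pi.sub_apply, Set.mem_Ioc]
    push_cast
    constructor <;> linarith
  · intro m n hmn
    refine Set.disjoint_left.2 fun x hm hn => hmn (funext fun i => ?_)
    have h1 := hm i
    have h2 := hn i
    simp only [Pi.sub_apply, Set.mem_Ioc] at h1 h2
    have h3 : (m i : ℝ) < n i + 1 := by linarith
    have h4 : (n i : ℝ) < m i + 1 := by linarith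
    norm_cast at h3 h4
    omega
  · exact fun m => (measurable_sub_const _) measurableSet_unitCube

lemma lintegral_eq_tsum_setLIntegral_unitCube {ι : Type*} [Fintype ι] (f : (ι → ℝ) → ℝ≥0∞) :
    ∫⁻ x, f x = ∑' m : ι → ℤ, ∫⁻ x in unitCube ι, f (x + fun i => (m i : ℝ)) := by
  conv_lhs => rw [volume_eq_sum_map_unitCube, lintegral_sum_measure]
  exact tsum_congr fun m =>
    (MeasurableEquiv.addRight (fun i => (m i : ℝ))).measurableEmbedding.lintegral_map f

lemma integral_eq_tsum_setIntegral_unitCube {ι : Type*} [Fintype ι] {f : (ι → ℝ) → ℂ}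
    (hf : Integrable f) :
    ∫ x, f x = ∑' m : ι → ℤ, ∫ x in unitCube ι, f (x + fun i => (m i : ℝ)) := by
  rw [volume_eq_sum_map_unitCube] at hf
  conv_lhs => rw [volume_eq_sum_map_unitCube, integral_sum_measure hf]
  exact tsum_congr fun m =>
    (MeasurableEquiv.addRight (fun i => (m i : ℝ))).measurableEmbedding.integral_map f

/-- If the integer translates of the support of `h` are essentially disjoint, then the Fourier
transform of `h` sampled on `ℤ^ι` has the same `ℓ²` norm as `h` has `L²` norm. -/
lemma tsum_enorm_sq_integral_latticeChar {ι : Type*} [Fintype ι] (h : (ι → ℝ) → ℂ)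
    (hint : Integrable h) (hL2 : MemLp h 2)
    (hdisj : ∀ᵐ x, ∃ m₀ : ι → ℤ, ∀ m ≠ m₀, h (x + fun i => (m i : ℝ)) = 0) :
    ∑' n : ι → ℤ, ‖∫ x, latticeChar n x * h x‖ₑ ^ 2 = ∫⁻ x, ‖h x‖ₑ ^ 2 := by
  let H : (ι → ℝ) → ℂ := fun x => ∑' m : ι → ℤ, h (x + fun i => (m i : ℝ))
  have hmeas : ∀ m : ι → ℤ, AEStronglyMeasurable (fun x => h (x + fun i => (m i : ℝ))) :=
    fun m => hint.1.comp_measurePreserving (measurePreserving_add_right volume _)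
  have hHmeas : AEStronglyMeasurable H := by
    refine aestronglyMeasurable_of_tendsto_ae Filter.atTop
      (f := fun (s : Finset (ι → ℤ)) x => ∑ m ∈ s, h (x + fun i => (m i : ℝ))) (fun s => ?_) ?_
    · exact Finset.aestronglyMeasurable_fun_sum s fun m _ => hmeas m
    · filter_upwards [hdisj] with x ⟨m₀, hm₀⟩
      exact (hasSum_single m₀ hm₀).summable.hasSum
  have hHsq : ∀ᵐ x, ‖H x‖ₑ ^ 2 = ∑' m : ι → ℤ, ‖h (x + fun i => (m i : ℝ))‖ₑ ^ 2 := by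
    filter_upwards [hdisj] with x ⟨m₀, hm₀⟩
    simp only [H]
    rw [tsum_eq_single m₀ hm₀, tsum_eq_single m₀ fun m hm => by simp [hm₀ m hm]]
  have hnorm : ∫⁻ x in unitCube ι, ‖H x‖ₑ ^ 2 = ∫⁻ x, ‖h x‖ₑ ^ 2 := by
    rw [lintegral_congr_ae (ae_restrict_of_ae hHsq),
      lintegral_tsum fun m => ((hmeas m).restrict.enorm.pow_const 2),
      lintegral_eq_tsum_setLIntegral_unitCube]
  have hfin : ∫⁻ x, ‖h x‖ₑ ^ 2 < ⊤ := by
    have := (eLpNorm_lt_top_iff_lintegral_rpow_enorm_lt_top (by simp) (by simp)).1 hL2.2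
    simpa using this
  have hH : MemLp H 2 (volume.restrict (unitCube ι)) := by
    refine ⟨hHmeas.restrict, ?_⟩
    rw [eLpNorm_lt_top_iff_lintegral_rpow_enorm_lt_top (by simp) (by simp)]
    simpa [hnorm] using hfin
  rw [← hnorm, ← tsum_enorm_sq_setIntegral_latticeChar H hH]
  refine tsum_congr fun n => ?_
  congr 2
  have hcint : Integrable fun x => latticeChar n x * h x :=
    hint.bdd_mul (c := 1) (continuous_latticeChar n).aestronglyMeasurable
      (Filter.Eventually.of_forall fun x => (norm_latticeChar n x).le)
  rw [integral_eq_tsum_setIntegral_unitCube hcint]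
  simp_rw [latticeChar_add_int]
  rw [← integral_tsum]
  · simp_rw [H, tsum_mul_left]
  · exact fun m => ((continuous_latticeChar n).aestronglyMeasurable.mul (hmeas m)).restrict
  · have h1 := lintegral_eq_tsum_setLIntegral_unitCube fun x => ‖latticeChar n x * h x‖ₑ
    simp_rw [latticeChar_add_int] at h1
    rw [← h1]
    exact hcint.2.ne

lemma continuous_fourierInv_of_integrable {d : ℕ} {g : Rd d → ℂ} (hg : Integrable g) :
    Continuous (𝓕⁻ g) :=
  VectorFourier.fourierIntegral_continuous Real.continuous_fourierChar
    (L := -innerₗ (Rd d)) continuous_inner.neg hg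

lemma integral_fourierInv_mul_eq {d : ℕ} {u g : Rd d → ℂ} (hu : Integrable u)
    (hg : Integrable g) : ∫ ξ, 𝓕⁻ u ξ * g ξ = ∫ x, u x * 𝓕⁻ g x := by
  have h := VectorFourier.integral_fourierIntegral_smul_eq_flip
    (μ := (volume : Measure (Rd d))) (ν := (volume : Measure (Rd d)))
    (L := -innerₗ (Rd d)) (f := u) (g := g) Real.continuous_fourierChar
    continuous_inner.neg hu hg
  have hflip : (-innerₗ (Rd d)).flip = -innerₗ (Rd d) := by
    ext x y
    simp [real_inner_comm]
  rw [hflip] at h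
  exact h

/-- Fourier inversion on `L²`: if the Plancherel transform of `f` is integrable, then `f` is a.e.
its inverse Fourier integral. -/
lemma IsFourier.ae_eq_fourierInv {d : ℕ} {F : L2 d ≃ₗᵢ[ℂ] L2 d} (hF : IsFourier F) (f : L2 d)
    (hint : Integrable (F f : Rd d → ℂ)) :
    (f : Rd d → ℂ) =ᵐ[volume] 𝓕⁻ (F f : Rd d → ℂ) := by
  have hcont := continuous_fourierInv_of_integrable hint
  refine ae_eq_of_integral_contDiff_smul_eq
    ((Lp.memLp f).locallyIntegrable (by norm_num)) hcont.locallyIntegrable fun u hu hu' => ?_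
  obtain ⟨φ, hφ⟩ : ∃ φ : SchwartzMap (Rd d) ℂ, ∀ x, φ x = (u x : ℂ) :=
    ⟨HasCompactSupport.toSchwartzMap (f := fun x => (u x : ℂ))
      (hu'.comp_left (g := fun r : ℝ => (r : ℂ)) Complex.ofReal_zero)
      (Complex.ofRealCLM.contDiff.comp hu), fun _ => rfl⟩
  obtain ⟨ψ, hφL⟩ : ∃ ψ : L2 d, (ψ : Rd d → ℂ) =ᵐ[volume] φ :=
    ⟨φ.toLp 2, φ.coeFn_toLp 2 volume⟩
  have hFφ : (F ψ : Rd d → ℂ) =ᵐ[volume] 𝓕 (φ : Rd d → ℂ) := by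
    have h := hF ψ (φ.integrable.congr hφL.symm)
    have h' : 𝓕 (ψ : Rd d → ℂ) = 𝓕 (φ : Rd d → ℂ) := by
      ext w
      rw [Real.fourier_eq, Real.fourier_eq]
      refine integral_congr_ae ?_
      filter_upwards [hφL] with x hx
      rw [hx]
    rwa [h'] at h
  have hconj : ∀ ξ, (starRingEnd ℂ) (𝓕 (φ : Rd d → ℂ) ξ) = 𝓕⁻ (φ : Rd d → ℂ) ξ := fun ξ => by
    rw [Real.fourier_eq', Real.fourierInv_eq', ← integral_conj]
    refine integral_congr_ae (Filter.Eventually.of_forall fun x => ?_)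
    simp [hφ, ← Complex.exp_conj, Complex.conj_ofNat]
  calc ∫ x, u x • (f : Rd d → ℂ) x
      = inner ℂ ψ f := by
        rw [L2.inner_def]
        refine integral_congr_ae ?_
        filter_upwards [hφL] with x hx
        rw [hx]
        simp [hφ, mul_comm]
    _ = inner ℂ (F ψ) (F f) := (F.inner_map_map _ _).symm
    _ = ∫ ξ, 𝓕⁻ (φ : Rd d → ℂ) ξ * (F f : Rd d → ℂ) ξ := by
        rw [L2.inner_def]
        refine integral_congr_ae ?_
        filter_upwards [hFφ] with ξ hξ
        rw [hξ, RCLike.inner_apply, hconj, mul_comm]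
    _ = ∫ x, φ x * 𝓕⁻ (F f : Rd d → ℂ) x := integral_fourierInv_mul_eq φ.integrable hint
    _ = ∫ x, u x • 𝓕⁻ (F f : Rd d → ℂ) x := by simp [hφ]

lemma integrable_coe_of_mem_Vband {d : ℕ} {F : L2 d ≃ₗᵢ[ℂ] L2 d} {E : Set (Rd d)}
    (hE : IsBand E) {f : L2 d} (hf : f ∈ Vband F E) : Integrable (F f : Rd d → ℂ) := by
  have : IsFiniteMeasure (volume.restrict E) := ⟨by simpa using hE.2⟩
  have h : IntegrableOn (F f : Rd d → ℂ) E :=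
    ((Lp.memLp (F f)).restrict E).integrable (by norm_num)
  refine (h.integrable_indicator hE.1).congr ?_
  filter_upwards [hf] with ξ hξ
  by_cases hmem : ξ ∈ E
  · simp [hmem]
  · simp [hmem, hξ hmem]

lemma exists_forall_ne_of_tsum_indicator_le_one {ι α : Type*} (E : Set α) (u : ι → α) [Nonempty ι]
    (h : ∑' m, E.indicator (fun _ => (1 : ℝ≥0∞)) (u m) ≤ 1) :
    ∃ m₀, ∀ m ≠ m₀, u m ∉ E := by
  by_contra! hcon
  obtain ⟨a, -, ha⟩ := hcon (Classical.arbitrary ι)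
  obtain ⟨b, hab, hb⟩ := hcon a
  have h2 := (ENNReal.sum_le_tsum {b, a}).trans h
  rw [Finset.sum_pair hab, Set.indicator_of_mem ha, Set.indicator_of_mem hb] at h2
  norm_num at h2

/-- The image of Lebesgue measure under `y ↦ M y`, viewed as a map into Euclidean space. -/
lemma map_mApp_toLp {d : ℕ} {M : Matrix (Fin d) (Fin d) ℝ} (hM : M.det ≠ 0) :
    Measure.map (fun y : Fin d → ℝ => mApp M (WithLp.toLp 2 y)) volume =
      ENNReal.ofReal |M.det⁻¹| • (volume : Measure (Rd d)) := by
  have h := Real.map_matrix_volume_pi_eq_smul_volume_pi hM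
  have hcomp : (fun y : Fin d → ℝ => mApp M (WithLp.toLp 2 y)) =
      (WithLp.toLp 2 : (Fin d → ℝ) → Rd d) ∘ Matrix.toLin' M := rfl
  have htoLp := PiLp.volume_preserving_toLp (Fin d)
  rw [hcomp, ← Measure.map_map htoLp.measurable
    (LinearMap.continuous_of_finiteDimensional _).measurable, h, Measure.map_smul, htoLp.map_eq]

lemma measurableEmbedding_mApp_toLp {d : ℕ} {M : Matrix (Fin d) (Fin d) ℝ} (hM : IsUnit M.det) :
    MeasurableEmbedding fun y : Fin d → ℝ => mApp M (WithLp.toLp 2 y) := by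
  have hcomp : (fun y : Fin d → ℝ => mApp M (WithLp.toLp 2 y)) =
      MeasurableEquiv.toLp 2 (Fin d → ℝ) ∘ Matrix.toLin' M := rfl
  rw [hcomp]
  exact (MeasurableEquiv.toLp 2 (Fin d → ℝ)).measurableEmbedding.comp
    ((LinearMap.continuous_of_finiteDimensional _).measurableEmbedding
      (Matrix.mulVec_injective_iff_isUnit.2 ((Matrix.isUnit_iff_isUnit_det M).2 hM)))

lemma inner_mApp_transpose_inv {d : ℕ} {A : Matrix (Fin d) (Fin d) ℝ} (hA : IsUnit A.det)
    (y : Fin d → ℝ) (z : Fin d → ℤ) :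
    inner ℝ (mApp (Aᵀ)⁻¹ (WithLp.toLp 2 y)) (mApp A (zv z)) = ∑ i, (z i : ℝ) * y i := by
  have h : inner ℝ (mApp (Aᵀ)⁻¹ (WithLp.toLp 2 y)) (mApp A (zv z)) =
      (A *ᵥ fun i => (z i : ℝ)) ⬝ᵥ ((Aᵀ)⁻¹ *ᵥ y) := by
    rw [EuclideanSpace.inner_eq_star_dotProduct]
    simp [mApp, zv]
    rfl
  rw [h, Matrix.dotProduct_mulVec, ← Matrix.mulVec_transpose, Matrix.mulVec_mulVec,
    Matrix.transpose_nonsing_inv, Matrix.transpose_transpose, Matrix.nonsing_inv_mul _ hA,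
    Matrix.one_mulVec]
  rfl

/-- classical single-lattice tightness, cf. [K65a]. If `E` is a band and
`A` an invertible matrix with `Σ_m χ_E(A^{*-1}(ξ + m)) ≤ 1` a.e., then for every `f ∈ V_E`,
`Σ_z |f(Az)|² = |det A|⁻¹ ‖f‖²`: the samples `{Az}` are tight on `E` with constant
`|det A|⁻¹`. -/
theorem tight_single_of_count_le_one {d : ℕ} (hd : 1 ≤ d)
    (F : L2 d ≃ₗᵢ[ℂ] L2 d) (hF : IsFourier F)
    (E : Set (Rd d)) (hE : IsBand E)
    (A : Matrix (Fin d) (Fin d) ℝ) (hA : IsUnit A.det)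
    (hcount : ∀ᵐ ξ ∂(volume : Measure (Rd d)),
      (∑' m : Fin d → ℤ, E.indicator (fun _ => (1 : ℝ≥0∞)) (mApp (Aᵀ)⁻¹ (ξ + zv m))) ≤ 1) :
    ∀ f ∈ Vband F E, ∀ f₀ : Rd d → ℂ, IsCRep f f₀ →
      ∑' z : Fin d → ℤ, (‖f₀ (mApp A (zv z))‖₊ : ℝ≥0∞) ^ 2 =
        ENNReal.ofReal |A.det|⁻¹ * (‖f‖₊ : ℝ≥0∞) ^ 2 := by
  intro f hf f₀ hf₀
  set g : Rd d → ℂ := (F f : Rd d → ℂ) with hg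
  set M := (Aᵀ)⁻¹ with hM
  have hdet : A.det ≠ 0 := hA.ne_zero
  have hMdet : M.det = A.det⁻¹ := by
    rw [hM, Matrix.det_nonsing_inv, Matrix.det_transpose, Ring.inverse_eq_inv']
  have hMunit : IsUnit M.det := by
    rw [hMdet]
    exact (inv_ne_zero hdet).isUnit
  set c : ℝ≥0∞ := ENNReal.ofReal |A.det| with hc
  have hc0 : c ≠ 0 := by simpa [hc] using hdet
  let Φ : (Fin d → ℝ) → Rd d := fun y => mApp M (WithLp.toLp 2 y)
  have hΦ : MeasurableEmbedding Φ := measurableEmbedding_mApp_toLp hMunit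
  have hmap : Measure.map Φ volume = c • (volume : Measure (Rd d)) := by
    have h := map_mApp_toLp hMunit.ne_zero
    rwa [hMdet, inv_inv] at h
  have hqmp : Measure.QuasiMeasurePreserving Φ volume volume :=
    ⟨hΦ.measurable, hmap ▸ Measure.smul_absolutelyContinuous⟩
  have hint : Integrable g := integrable_coe_of_mem_Vband hE hf
  have hinv : f₀ = 𝓕⁻ g := by
    have hcont := continuous_fourierInv_of_integrable hint
    exact (hf₀.1.ae_eq_iff_eq volume hcont).1 (hf₀.2.symm.trans (hF.ae_eq_fourierInv f hint))
  have hhint : Integrable (g ∘ Φ) := by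
    rw [← hΦ.integrable_map_iff, hmap]
    exact hint.smul_measure ENNReal.ofReal_ne_top
  have hhL2 : MemLp (g ∘ Φ) 2 := by
    rw [← hΦ.memLp_map_measure_iff, hmap]
    exact (Lp.memLp (F f)).smul_measure ENNReal.ofReal_ne_top
  have hdisj : ∀ᵐ y : Fin d → ℝ, ∃ m₀ : Fin d → ℤ, ∀ m ≠ m₀,
      (g ∘ Φ) (y + fun i => (m i : ℝ)) = 0 := by
    have h1 := (PiLp.volume_preserving_toLp (Fin d)).quasiMeasurePreserving.ae hcount
    have h2 : ∀ᵐ y : Fin d → ℝ, ∀ m : Fin d → ℤ, Φ (y + fun i => (m i : ℝ)) ∉ E →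
        g (Φ (y + fun i => (m i : ℝ))) = 0 :=
      ae_all_iff.2 fun m =>
        (measurePreserving_add_right volume _).quasiMeasurePreserving.ae (hqmp.ae hf)
    filter_upwards [h1, h2] with y hy1 hy2
    obtain ⟨m₀, hm₀⟩ := exists_forall_ne_of_tsum_indicator_le_one E _ hy1
    exact ⟨m₀, fun m hm => hy2 m (hm₀ m hm)⟩
  have hsample : ∀ z : Fin d → ℤ,
      ∫ y, latticeChar (-z) y * (g ∘ Φ) y = |A.det| • f₀ (mApp A (zv z)) := fun z => by
    let k : Rd d → ℂ := fun v =>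
      Complex.exp (((2 * Real.pi * inner ℝ v (mApp A (zv z)) : ℝ) : ℂ) * Complex.I) • g v
    have hk : ∀ y, latticeChar (-z) y * (g ∘ Φ) y = k (Φ y) := fun y => by
      simp only [k, Φ, inner_mApp_transpose_inv hA, M, latticeChar, Function.comp_apply,
        smul_eq_mul]
      congr 4
      simp
    calc ∫ y, latticeChar (-z) y * (g ∘ Φ) y = ∫ y, k (Φ y) :=
          integral_congr_ae (Filter.Eventually.of_forall hk)
      _ = ∫ v, k v ∂(Measure.map Φ volume) := (hΦ.integral_map k).symm
      _ = |A.det| • f₀ (mApp A (zv z)) := by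
          rw [hmap, integral_smul_measure, hinv, Real.fourierInv_eq',
            ENNReal.toReal_ofReal (abs_nonneg _)]
  have hmain := tsum_enorm_sq_integral_latticeChar (g ∘ Φ) hhint hhL2 hdisj
  have hnorm : ∫⁻ y, ‖(g ∘ Φ) y‖ₑ ^ 2 = c * ‖f‖ₑ ^ 2 := by
    calc ∫⁻ y, ‖(g ∘ Φ) y‖ₑ ^ 2 = ∫⁻ ξ, ‖g ξ‖ₑ ^ 2 ∂(Measure.map Φ volume) :=
          (hΦ.lintegral_map fun ξ => ‖g ξ‖ₑ ^ 2).symm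
      _ = c * ∫⁻ ξ, ‖g ξ‖ₑ ^ 2 := by rw [hmap, lintegral_smul_measure, smul_eq_mul]
      _ = c * ‖f‖ₑ ^ 2 := by
          have hFf : ‖f‖ₑ = ‖F f‖ₑ := by simp [enorm_eq_nnnorm]
          rw [hFf, Lp.enorm_def, eLpNorm_eq_lintegral_rpow_enorm_toReal (by simp) (by simp),
            ← ENNReal.rpow_natCast, ← ENNReal.rpow_mul]
          simp [hg]
  rw [← (Equiv.neg (Fin d → ℤ)).tsum_eq, hnorm] at hmain
  simp only [Equiv.neg_apply, hsample, enorm_smul, mul_pow, ENNReal.tsum_mul_left] at hmain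
  have habs : ‖|A.det|‖ₑ = c := by rw [Real.enorm_eq_ofReal (abs_nonneg _)]
  rw [habs, pow_two c, mul_assoc] at hmain
  have hmain' := (ENNReal.mul_right_inj hc0 ENNReal.ofReal_ne_top).1 hmain
  have hinvc : ENNReal.ofReal |A.det|⁻¹ = c⁻¹ := by
    rw [hc, ENNReal.ofReal_inv_of_pos (abs_pos.2 hdet)]
  rw [hinvc]
  simp only [← enorm_eq_nnnorm]
  rw [← hmain', ← mul_assoc, ENNReal.inv_mul_cancel hc0 ENNReal.ofReal_ne_top, one_mul]

end GSL
end
end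

section
/- Let E ⊆ ℝ^d be a band, A_1,…,A_n invertible real d×d matrices, β_1,…,β_n ∈ ℝ^d, and let Θ_A : V_E → ⊕_{j=1}^n ℓ²(ℤ^d), f ↦ ((f(A_j z + β_j))_{z∈ℤ^d})_{j=1}^n (using the continuous representative of f). Then Θ_A is well defined and bounded if and only if for each j = 1,…,n the ℤ^d-periodic function ξ ↦ Σ_{k∈ℤ^d} χ_E(A_j^{*-1}(ξ + k)) is essentially bounded on ℝ^d. -/
open MeasureTheory Complex Matrix
open scoped FourierTransform ENNReal NNReal RealInnerProductSpace Classical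

noncomputable section

namespace GSL

theorem IsFourier.apply_eq {d : ℕ} {F : L2 d ≃ₗᵢ[ℂ] L2 d} (hF : IsFourier F) (f : L2 d) :
    F f = Lp.fourierTransformₗᵢ (Rd d) ℂ f := by
  refine DenseRange.induction_on
    (p := fun f : L2 d => F f = Lp.fourierTransformₗᵢ (Rd d) ℂ f)
    (SchwartzMap.denseRange_toLpCLM (p := 2) (μ := (volume : Measure (Rd d)))
      ENNReal.ofNat_ne_top) f ?_ ?_
  · exact isClosed_eq F.continuous (Lp.fourierTransformₗᵢ (Rd d) ℂ).continuous
  · intro φ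
    have h1 : ((φ.toLp 2 : L2 d) : Rd d → ℂ) =ᵐ[volume] φ := φ.coeFn_toLp 2 volume
    have h2 : Integrable ((φ.toLp 2 : L2 d) : Rd d → ℂ) volume := φ.integrable.congr h1.symm
    have h3 : Lp.fourierTransformₗᵢ (Rd d) ℂ (φ.toLp 2) = (𝓕 φ).toLp 2 :=
      SchwartzMap.toLp_fourier_eq φ
    have h4 : 𝓕 ((φ.toLp 2 : L2 d) : Rd d → ℂ) = 𝓕 (φ : Rd d → ℂ) := by
      ext ξ
      rw [Real.fourier_eq, Real.fourier_eq]
      refine integral_congr_ae ?_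
      filter_upwards [h1] with x hx
      rw [hx]
    change F (φ.toLp 2) = Lp.fourierTransformₗᵢ (Rd d) ℂ (φ.toLp 2)
    rw [h3]
    refine Lp.ext ?_
    filter_upwards [hF _ h2, (𝓕 φ).coeFn_toLp 2 volume] with ξ hξ hξ'
    rw [hξ, hξ', h4, SchwartzMap.fourier_coe]

theorem integral_fourierInv_smul_eq {d : ℕ} {f g : Rd d → ℂ} (hf : Integrable f)
    (hg : Integrable g) : ∫ ξ, 𝓕⁻ f ξ • g ξ = ∫ x, f x • 𝓕⁻ g x := by
  have h := VectorFourier.integral_fourierIntegral_smul_eq_flip (μ := (volume : Measure (Rd d)))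
    (ν := (volume : Measure (Rd d))) (e := Real.fourierChar) (L := -innerₗ (Rd d)) (f := f) (g := g)
    Real.continuous_fourierChar (by simpa using! continuous_inner.neg) hf hg
  have hflip : (-innerₗ (Rd d)).flip = -innerₗ (Rd d) := by
    ext x y
    simp [real_inner_comm]
  rw [hflip] at h
  exact h

theorem Lp.coeFn_fourierInv_ae_eq {d : ℕ} (g : L2 d) (hg : Integrable (g : Rd d → ℂ)) :
    ((𝓕⁻ g : L2 d) : Rd d → ℂ) =ᵐ[volume] 𝓕⁻ (g : Rd d → ℂ) := by
  have hc : Continuous (𝓕⁻ (g : Rd d → ℂ)) :=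
    VectorFourier.fourierIntegral_continuous Real.continuous_fourierChar
      (by simpa using! continuous_inner.neg) hg
  refine ae_eq_of_integral_contDiff_smul_eq
    ((Lp.memLp (𝓕⁻ g : L2 d)).locallyIntegrable (by norm_num)) hc.locallyIntegrable ?_
  intro φ hφ hφc
  have hφ1 : ContDiff ℝ (⊤ : ℕ∞) (fun x => (φ x : ℂ)) := Complex.ofRealCLM.contDiff.comp hφ
  have hφ2 : HasCompactSupport (fun x => (φ x : ℂ)) := hφc.comp_left Complex.ofReal_zero
  let ψ : SchwartzMap (Rd d) ℂ := hφ2.toSchwartzMap hφ1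
  have h := congrArg (fun T => T ψ) (Lp.fourierInv_toTemperedDistribution_eq g)
  simp only [TemperedDistribution.fourierInv_apply, Lp.toTemperedDistribution_apply] at h
  rw [SchwartzMap.fourierInv_coe, integral_fourierInv_smul_eq ψ.integrable hg] at h
  simpa [ψ] using h.symm

/-- Band-limited functions are integrals of complex exponentials against their spectrum. -/
theorem IsCRep.eq_integral {d : ℕ} {F : L2 d ≃ₗᵢ[ℂ] L2 d} (hF : IsFourier F) {f : L2 d}
    {f₀ : Rd d → ℂ} (hf : IsCRep f f₀) (hi : Integrable (F f : Rd d → ℂ)) (x : Rd d) :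
    f₀ x = ∫ ξ, (Real.fourierChar ⟪ξ, x⟫ : ℂ) * (F f : Rd d → ℂ) ξ := by
  have hc : Continuous (𝓕⁻ (F f : Rd d → ℂ)) :=
    VectorFourier.fourierIntegral_continuous Real.continuous_fourierChar
      (by simpa using! continuous_inner.neg) hi
  have h1 := Lp.coeFn_fourierInv_ae_eq (F f) hi
  have h2 : (𝓕⁻ (F f) : L2 d) = f := by
    rw [hF.apply_eq]
    exact (Lp.fourierTransformₗᵢ (Rd d) ℂ).symm_apply_apply f
  rw [h2] at h1
  have h3 : f₀ = 𝓕⁻ (F f : Rd d → ℂ) :=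
    (Continuous.ae_eq_iff_eq volume hf.1 hc).1 (hf.2.symm.trans h1)
  rw [h3, Real.fourierInv_eq]
  simp [Circle.smul_def]

theorem exists_isCRep {d : ℕ} {F : L2 d ≃ₗᵢ[ℂ] L2 d} (hF : IsFourier F) {f : L2 d}
    (hi : Integrable (F f : Rd d → ℂ)) : ∃ f₀, IsCRep f f₀ := by
  refine ⟨𝓕⁻ (F f : Rd d → ℂ),
    VectorFourier.fourierIntegral_continuous Real.continuous_fourierChar
      (by simpa using! continuous_inner.neg) hi, ?_⟩
  have h1 := Lp.coeFn_fourierInv_ae_eq (F f) hi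
  have h2 : (𝓕⁻ (F f) : L2 d) = f := by
    rw [hF.apply_eq]
    exact (Lp.fourierTransformₗᵢ (Rd d) ℂ).symm_apply_apply f
  rwa [h2] at h1

/-- The half-open unit cell `(0,1]^d`. -/
def cell (d : ℕ) : Set (Rd d) := {x | ∀ i, x i ∈ Set.Ioc (0 : ℝ) 1}

theorem zv_apply {d : ℕ} (z : Fin d → ℤ) (i : Fin d) : zv z i = (z i : ℝ) := rfl

theorem zv_add {d : ℕ} (k l : Fin d → ℤ) : zv (k + l) = zv k + zv l := by
  ext i
  simp [zv_apply]

theorem cell_eq_preimage (d : ℕ) :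
    cell d = (WithLp.ofLp : Rd d → Fin d → ℝ) ⁻¹'
      {x | ∀ i, x i ∈ Set.Ioc ((0 : Fin d → ℝ) i) ((0 : Fin d → ℝ) i + 1)} := by
  ext x
  simp [cell]

theorem lintegral_cell_eq {d : ℕ} (φ : Rd d → ℝ≥0∞) :
    ∫⁻ x in cell d, φ x = ∫⁻ x in {x : Fin d → ℝ | ∀ i, x i ∈
      Set.Ioc ((0 : Fin d → ℝ) i) ((0 : Fin d → ℝ) i + 1)}, φ (WithLp.toLp 2 x) := by
  rw [cell_eq_preimage]
  exact (EuclideanSpace.volume_preserving_symm_measurableEquiv_toLp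
    (Fin d)).setLIntegral_comp_preimage_emb (MeasurableEquiv.measurableEmbedding _)
      (fun x => φ (WithLp.toLp 2 x)) _

theorem integral_cell_eq {d : ℕ} (φ : Rd d → ℂ) :
    ∫ x in cell d, φ x = ∫ x in {x : Fin d → ℝ | ∀ i, x i ∈
      Set.Ioc ((0 : Fin d → ℝ) i) ((0 : Fin d → ℝ) i + 1)}, φ (WithLp.toLp 2 x) := by
  rw [cell_eq_preimage]
  exact (EuclideanSpace.volume_preserving_symm_measurableEquiv_toLp
    (Fin d)).setIntegral_preimage_emb (MeasurableEquiv.measurableEmbedding _)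
      (fun x => φ (WithLp.toLp 2 x)) _

section Torus

local instance inst_s15 : MeasureSpace UnitAddCircle := ⟨AddCircle.haarAddCircle⟩

local instance : Measure.IsAddHaarMeasure (volume : Measure UnitAddCircle) :=
  inferInstanceAs (Measure.IsAddHaarMeasure AddCircle.haarAddCircle)

local instance inst_s15_2 : IsProbabilityMeasure (volume : Measure UnitAddCircle) :=
  inferInstanceAs (IsProbabilityMeasure AddCircle.haarAddCircle)

/-- The section of the quotient map from the cell to the torus. -/
def torusLift {d : ℕ} (t : UnitAddTorus (Fin d)) : Rd d :=
  WithLp.toLp 2 (UnitAddTorus.measurableEquivPiIoc (0 : Fin d → ℝ) t).1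

theorem measurable_torusLift {d : ℕ} : Measurable (torusLift (d := d)) :=
  (WithLp.measurable_toLp 2 _).comp
    (measurable_subtype_coe.comp (UnitAddTorus.measurableEquivPiIoc (0 : Fin d → ℝ)).measurable)

theorem torusLift_coe {d : ℕ} {x : Fin d → ℝ}
    (hx : x ∈ {x : Fin d → ℝ | ∀ i, x i ∈
      Set.Ioc ((0 : Fin d → ℝ) i) ((0 : Fin d → ℝ) i + 1)}) :
    torusLift (fun i => (x i : UnitAddCircle)) = WithLp.toLp 2 x := by
  have := (UnitAddTorus.measurableEquivPiIoc (0 : Fin d → ℝ)).apply_symm_apply ⟨x, hx⟩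
  rw [UnitAddTorus.coe_symm_measurableEquivPiIoc_apply] at this
  rw [torusLift, this]

theorem mFourier_coe {d : ℕ} (z : Fin d → ℤ) (x : Fin d → ℝ) :
    UnitAddTorus.mFourier z (fun i => (x i : UnitAddCircle)) =
      (Real.fourierChar ⟪(WithLp.toLp 2 x : Rd d), zv z⟫ : ℂ) := by
  rw [Real.fourierChar_apply]
  simp only [UnitAddTorus.mFourier, ContinuousMap.coe_mk, fourier_coe_apply]
  rw [← Complex.exp_sum]
  congr 1
  simp only [PiLp.inner_apply, zv_apply]
  push_cast
  simp only [Finset.mul_sum, Finset.sum_mul]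
  refine Finset.sum_congr rfl fun i _ => ?_
  simp
  ring

theorem lintegral_torusLift {d : ℕ} (φ : Rd d → ℝ≥0∞) :
    ∫⁻ t : UnitAddTorus (Fin d), φ (torusLift t) = ∫⁻ x in cell d, φ x := by
  have h := UnitAddTorus.lintegral_preimage (fun t => φ (torusLift t)) (0 : Fin d → ℝ)
  refine (h.trans ?_).trans (lintegral_cell_eq φ).symm
  refine setLIntegral_congr_fun (MeasurableSet.univ_pi' fun i => measurableSet_Ioc) ?_
  intro x hx
  simp only [torusLift_coe hx]

theorem mFourierCoeff_torusLift {d : ℕ} (H : Rd d → ℂ) (z : Fin d → ℤ) :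
    UnitAddTorus.mFourierCoeff (fun t => H (torusLift t)) (-z) =
      ∫ x in cell d, (Real.fourierChar ⟪x, zv z⟫ : ℂ) * H x := by
  rw [UnitAddTorus.mFourierCoeff_eq_integral _ _ (0 : Fin d → ℝ), integral_cell_eq, neg_neg]
  refine setIntegral_congr_fun (MeasurableSet.univ_pi' fun i => measurableSet_Ioc) ?_
  intro x hx
  simp only [torusLift_coe hx, mFourier_coe, smul_eq_mul]

/-- Parseval's identity on the unit cell. -/
theorem tsum_enorm_sq_integral_cell {d : ℕ} {H : Rd d → ℂ} (hH : Measurable H)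
    (h2 : ∫⁻ x in cell d, ‖H x‖ₑ ^ 2 < ∞) :
    ∑' z : Fin d → ℤ, ‖∫ x in cell d, (Real.fourierChar ⟪x, zv z⟫ : ℂ) * H x‖ₑ ^ 2 =
      ∫⁻ x in cell d, ‖H x‖ₑ ^ 2 := by
  set G : UnitAddTorus (Fin d) → ℂ := fun t => H (torusLift t) with hG
  have hGm : Measurable G := hH.comp measurable_torusLift
  have hGl : ∫⁻ t, ‖G t‖ₑ ^ 2 = ∫⁻ x in cell d, ‖H x‖ₑ ^ 2 :=
    lintegral_torusLift (fun x => ‖H x‖ₑ ^ 2)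
  have hG2 : MemLp G 2 volume := by
    refine ⟨hGm.aestronglyMeasurable, ?_⟩
    rw [eLpNorm_lt_top_iff_lintegral_rpow_enorm_lt_top (by norm_num) (by norm_num)]
    simpa using hGl.trans_lt h2
  have hs := UnitAddTorus.hasSum_sq_mFourierCoeff hG2.toLp
  have hcoe := hG2.coeFn_toLp
  have hc : ∀ z, UnitAddTorus.mFourierCoeff (hG2.toLp : UnitAddTorus (Fin d) → ℂ) (-z) =
      ∫ x in cell d, (Real.fourierChar ⟪x, zv z⟫ : ℂ) * H x := by
    intro z
    rw [← mFourierCoeff_torusLift]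
    refine integral_congr_ae ?_
    filter_upwards [hcoe] with t ht
    rw [ht]
  have hi : ∫ t, ‖(hG2.toLp : UnitAddTorus (Fin d) → ℂ) t‖ ^ 2 = ∫ t, ‖G t‖ ^ 2 := by
    refine integral_congr_ae ?_
    filter_upwards [hcoe] with t ht
    rw [ht]
  rw [hi] at hs
  have hs' := (Equiv.neg (Fin d → ℤ)).hasSum_iff.2 hs
  simp only [Function.comp_def, Equiv.neg_apply, hc] at hs'
  have := ENNReal.ofReal_tsum_of_nonneg (fun z => sq_nonneg _) hs'.summable
  rw [hs'.tsum_eq, ofReal_integral_eq_lintegral_ofReal (hG2.integrable_norm_pow (by norm_num))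
    (Filter.Eventually.of_forall fun t => sq_nonneg _)] at this
  simp only [ENNReal.ofReal_pow (norm_nonneg _), ofReal_norm] at this
  rw [← this, hGl]

theorem volume_cell (d : ℕ) : volume (cell d) = 1 := by
  have h := lintegral_torusLift (d := d) fun _ => 1
  simpa using h.symm

end Torus

theorem measurable_ceil_sub_one {d : ℕ} :
    Measurable fun (x : Rd d) (i : Fin d) => ⌈x i⌉ - 1 := by
  refine measurable_pi_lambda _ fun i => ?_
  exact (Int.measurable_ceil.comp (by fun_prop)).sub_const 1

theorem preimage_ceil_eq {d : ℕ} (k : Fin d → ℤ) :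
    (fun (x : Rd d) (i : Fin d) => ⌈x i⌉ - 1) ⁻¹' {k} = (fun x => x + zv (-k)) ⁻¹' cell d := by
  ext x
  simp only [Set.mem_preimage, Set.mem_singleton_iff, funext_iff, cell, Set.mem_ofPred_eq,
    PiLp.add_apply, zv_apply, Pi.neg_apply, Set.mem_Ioc]
  refine forall_congr' fun i => ?_
  rw [sub_eq_iff_eq_add, Int.ceil_eq_iff]
  push_cast
  constructor <;> rintro ⟨h1, h2⟩ <;> constructor <;> linarith

/-- Folding an integral over `ℝ^d` onto the unit cell. -/
theorem lintegral_eq_tsum_cell {d : ℕ} (φ : Rd d → ℝ≥0∞) :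
    ∫⁻ x, φ x = ∑' k : Fin d → ℤ, ∫⁻ x in cell d, φ (x + zv k) := by
  have hU : (⋃ k : Fin d → ℤ, (fun (x : Rd d) (i : Fin d) => ⌈x i⌉ - 1) ⁻¹' {k}) = Set.univ := by
    ext x
    simp
  rw [← setLIntegral_univ, ← hU, lintegral_iUnion
    (fun k => measurable_ceil_sub_one (measurableSet_singleton k))
    (fun k l hkl => Disjoint.preimage _ (by simpa using hkl))]
  refine tsum_congr fun k => ?_
  rw [preimage_ceil_eq]
  have h := (measurePreserving_add_right (volume : Measure (Rd d))
    (zv (-k))).setLIntegral_comp_preimage_emb (measurableEmbedding_addRight _)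
      (fun x => φ (x + zv k)) (cell d)
  rw [← h]
  simp only [add_assoc, ← zv_add, neg_add_cancel]
  simp [show zv (0 : Fin d → ℤ) = 0 by ext i; simp [zv_apply]]

theorem integral_eq_tsum_cell {d : ℕ} {φ : Rd d → ℂ} (hφ : Integrable φ) :
    ∫ x, φ x = ∑' k : Fin d → ℤ, ∫ x in cell d, φ (x + zv k) := by
  have hU : (⋃ k : Fin d → ℤ, (fun (x : Rd d) (i : Fin d) => ⌈x i⌉ - 1) ⁻¹' {k}) = Set.univ := by
    ext x
    simp
  rw [← setIntegral_univ, ← hU, integral_iUnion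
    (fun k => measurable_ceil_sub_one (measurableSet_singleton k))
    (fun k l hkl => Disjoint.preimage _ (by simpa using hkl)) hφ.integrableOn]
  refine tsum_congr fun k => ?_
  rw [preimage_ceil_eq]
  have h := (measurePreserving_add_right (volume : Measure (Rd d))
    (zv (-k))).setIntegral_preimage_emb (measurableEmbedding_addRight _)
      (fun x => φ (x + zv k)) (cell d)
  rw [← h]
  simp only [add_assoc, ← zv_add, neg_add_cancel]
  simp [show zv (0 : Fin d → ℤ) = 0 by ext i; simp [zv_apply]]

theorem enorm_fourierChar (t : ℝ) : ‖(Real.fourierChar t : ℂ)‖ₑ = 1 := by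
  rw [← ofReal_norm, Circle.norm_coe, ENNReal.ofReal_one]

theorem measurable_fourierChar_inner {d : ℕ} (y : Rd d) :
    Measurable fun x : Rd d => (Real.fourierChar ⟪x, y⟫ : ℂ) :=
  (continuous_subtype_val.comp (Real.continuous_fourierChar.comp (by fun_prop))).measurable

theorem fourierChar_inner_zv_add {d : ℕ} (x : Rd d) (k z : Fin d → ℤ) :
    (Real.fourierChar ⟪x + zv k, zv z⟫ : ℂ) = Real.fourierChar ⟪x, zv z⟫ := by
  have : (Real.fourierChar ⟪(zv k : Rd d), zv z⟫ : ℂ) = 1 := by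
    rw [Real.fourierChar_apply]
    refine Complex.exp_eq_one_iff.2 ⟨∑ i, z i * k i, ?_⟩
    simp only [PiLp.inner_apply, zv_apply]
    push_cast
    simp
    ring
  rw [inner_add_left, AddChar.map_add_eq_mul, Circle.coe_mul, this, mul_one]

/-- The periodization identity: the exponential integrals of an integrable function are the
Fourier coefficients of its periodization, so Parseval's identity applies. -/
theorem tsum_enorm_sq_integral {d : ℕ} {h : Rd d → ℂ} (hm : Measurable h) (hi : Integrable h)
    (h2 : ∫⁻ x in cell d, ‖∑' k : Fin d → ℤ, h (x + zv k)‖ₑ ^ 2 < ∞) :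
    ∑' z : Fin d → ℤ, ‖∫ x, (Real.fourierChar ⟪x, zv z⟫ : ℂ) * h x‖ₑ ^ 2 =
      ∫⁻ x in cell d, ‖∑' k : Fin d → ℤ, h (x + zv k)‖ₑ ^ 2 := by
  have hHm : Measurable fun x : Rd d => ∑' k : Fin d → ℤ, h (x + zv k) := by
    exact Measurable.tsum fun k => hm.comp (measurable_add_const _)
  rw [← tsum_enorm_sq_integral_cell hHm h2]
  refine tsum_congr fun z => ?_
  have hcm := measurable_fourierChar_inner (zv z)
  have h_int : Integrable fun x => (Real.fourierChar ⟪x, zv z⟫ : ℂ) * h x :=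
    hi.bdd_mul (c := 1) hcm.aestronglyMeasurable
      (Filter.Eventually.of_forall fun x => (Circle.norm_coe _).le)
  rw [integral_eq_tsum_cell h_int]
  simp only [fourierChar_inner_zv_add]
  simp only [← tsum_mul_left]
  rw [integral_tsum]
  · exact fun k => (hcm.mul (hm.comp (measurable_add_const _))).aestronglyMeasurable
  · have := lintegral_eq_tsum_cell (fun x => ‖h x‖ₑ)
    simp only [enorm_mul, enorm_fourierChar, one_mul]
    rw [← this]
    exact hi.2.ne

theorem measurable_mApp {d : ℕ} (B : Matrix (Fin d) (Fin d) ℝ) : Measurable (mApp B) := by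
  have : Continuous (mApp B) :=
    (EuclideanSpace.equiv (Fin d) ℝ).symm.continuous.comp
      (Continuous.matrix_mulVec continuous_const (EuclideanSpace.equiv (Fin d) ℝ).continuous)
  exact this.measurable

theorem mApp_mApp {d : ℕ} (B C : Matrix (Fin d) (Fin d) ℝ) (x : Rd d) :
    mApp B (mApp C x) = mApp (B * C) x := by
  simp only [mApp, ContinuousLinearEquiv.apply_symm_apply, Matrix.mulVec_mulVec]

theorem mApp_one {d : ℕ} (x : Rd d) : mApp 1 x = x := by
  simp [mApp]

theorem inner_mApp {d : ℕ} (B : Matrix (Fin d) (Fin d) ℝ) (x y : Rd d) :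
    ⟪x, mApp B y⟫ = ⟪mApp Bᵀ x, y⟫ := by
  simp only [EuclideanSpace.inner_eq_star_dotProduct, mApp]
  simp only [Matrix.mulVec_transpose]
  change (B *ᵥ y.ofLp) ⬝ᵥ x.ofLp = y.ofLp ⬝ᵥ (x.ofLp ᵥ* B)
  rw [dotProduct_comm, Matrix.dotProduct_mulVec, dotProduct_comm]

/-- `mApp B` as a linear map. -/
def mAppLin {d : ℕ} (B : Matrix (Fin d) (Fin d) ℝ) : Rd d →ₗ[ℝ] Rd d :=
  (EuclideanSpace.equiv (Fin d) ℝ).symm.toLinearMap ∘ₗ B.mulVecLin ∘ₗ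
    (EuclideanSpace.equiv (Fin d) ℝ).toLinearMap

theorem coe_mAppLin {d : ℕ} (B : Matrix (Fin d) (Fin d) ℝ) : ⇑(mAppLin B) = mApp B := rfl

theorem exists_map_mApp {d : ℕ} {B : Matrix (Fin d) (Fin d) ℝ} (hB : IsUnit B.det) :
    ∃ c : ℝ, 0 < c ∧
      (volume : Measure (Rd d)).map (mApp B) = ENNReal.ofReal c • volume := by
  have h1 : mAppLin B * mAppLin B⁻¹ = 1 := by
    ext1 x
    change mApp B (mApp B⁻¹ x) = x
    rw [mApp_mApp, Matrix.mul_nonsing_inv _ hB, mApp_one]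
  have h2 : LinearMap.det (mAppLin B) ≠ 0 := by
    intro h
    have := congrArg LinearMap.det h1
    rw [map_mul, h, zero_mul, map_one] at this
    exact zero_ne_one this
  refine ⟨|(LinearMap.det (mAppLin B))⁻¹|, abs_pos.2 (inv_ne_zero h2), ?_⟩
  rw [← coe_mAppLin]
  exact Measure.map_linearMap_addHaar_eq_smul_addHaar volume h2

theorem enorm_sq_L2 {d : ℕ} {f : L2 d} {g : Rd d → ℂ} (hg : (f : Rd d → ℂ) =ᵐ[volume] g) :
    (‖f‖₊ : ℝ≥0∞) ^ 2 = ∫⁻ x, ‖g x‖ₑ ^ 2 := by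
  have h := Lp.enorm_def f
  rw [eLpNorm_congr_ae hg, eLpNorm_eq_lintegral_rpow_enorm_toReal (by norm_num) (by norm_num)] at h
  change ‖f‖ₑ ^ 2 = _
  rw [h, ← ENNReal.rpow_natCast, ← ENNReal.rpow_mul]
  simp

/-- The part of the spectrum `g` seen by the samples `{A z + β}`, in the coordinates
`η = Aᵀ ξ`. -/
def pull {d : ℕ} (A : Matrix (Fin d) (Fin d) ℝ) (β : Rd d) (g : Rd d → ℂ) (η : Rd d) : ℂ :=
  (Real.fourierChar ⟪mApp (Aᵀ)⁻¹ η, β⟫ : ℂ) * g (mApp (Aᵀ)⁻¹ η)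

theorem measurable_pull {d : ℕ} (A : Matrix (Fin d) (Fin d) ℝ) (β : Rd d) {g : Rd d → ℂ}
    (hg : Measurable g) : Measurable (pull A β g) :=
  ((measurable_fourierChar_inner β).comp (measurable_mApp _)).mul (hg.comp (measurable_mApp _))

theorem pull_mApp {d : ℕ} {A : Matrix (Fin d) (Fin d) ℝ} (hA : IsUnit A.det) (β : Rd d)
    (g : Rd d → ℂ) (ξ : Rd d) :
    pull A β g (mApp Aᵀ ξ) = (Real.fourierChar ⟪ξ, β⟫ : ℂ) * g ξ := by
  rw [pull, mApp_mApp, Matrix.nonsing_inv_mul _ (by rwa [Matrix.det_transpose]), mApp_one]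

section ChangeOfVariables

variable {d : ℕ} {A : Matrix (Fin d) (Fin d) ℝ} {c : ℝ}

theorem lintegral_comp_mApp {B : Matrix (Fin d) (Fin d) ℝ}
    (hmap : (volume : Measure (Rd d)).map (mApp B) = ENNReal.ofReal c • volume)
    {φ : Rd d → ℝ≥0∞} (hφ : Measurable φ) :
    ∫⁻ ξ, φ (mApp B ξ) = ENNReal.ofReal c * ∫⁻ η, φ η := by
  rw [← lintegral_map hφ (measurable_mApp _), hmap, lintegral_smul_measure, smul_eq_mul]

theorem lintegral_enorm_pull_sq (hA : IsUnit A.det) (β : Rd d)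
    (hmap : (volume : Measure (Rd d)).map (mApp Aᵀ) = ENNReal.ofReal c • volume)
    {g : Rd d → ℂ} (hg : Measurable g) :
    ENNReal.ofReal c * ∫⁻ η, ‖pull A β g η‖ₑ ^ 2 = ∫⁻ ξ, ‖g ξ‖ₑ ^ 2 := by
  rw [← lintegral_comp_mApp hmap ((measurable_pull A β hg).enorm.pow_const 2)]
  simp only [pull_mApp hA, enorm_mul, enorm_fourierChar, one_mul]

theorem integrable_pull (hA : IsUnit A.det) (β : Rd d) (hc : 0 < c)
    (hmap : (volume : Measure (Rd d)).map (mApp Aᵀ) = ENNReal.ofReal c • volume)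
    {g : Rd d → ℂ} (hg : Measurable g) (hi : Integrable g) : Integrable (pull A β g) := by
  refine ⟨(measurable_pull A β hg).aestronglyMeasurable, ?_⟩
  have h := lintegral_comp_mApp hmap (measurable_pull A β hg).enorm
  simp only [pull_mApp hA, enorm_mul, enorm_fourierChar, one_mul] at h
  have h2 : ENNReal.ofReal c * ∫⁻ η, ‖pull A β g η‖ₑ < ∞ := h ▸ hi.2
  exact ENNReal.lt_top_of_mul_ne_top_right h2.ne (by simpa using hc)

theorem integral_mul_pull (hA : IsUnit A.det) (β x : Rd d) (hc : 0 < c)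
    (hmap : (volume : Measure (Rd d)).map (mApp Aᵀ) = ENNReal.ofReal c • volume)
    {g : Rd d → ℂ} (hg : Measurable g) :
    ∫ ξ, (Real.fourierChar ⟪ξ, mApp A x + β⟫ : ℂ) * g ξ =
      c * ∫ η, (Real.fourierChar ⟪η, x⟫ : ℂ) * pull A β g η := by
  have h : ∫ η, (Real.fourierChar ⟪η, x⟫ : ℂ) * pull A β g η
      ∂((volume : Measure (Rd d)).map (mApp Aᵀ)) =
      ∫ ξ, (Real.fourierChar ⟪mApp Aᵀ ξ, x⟫ : ℂ) * pull A β g (mApp Aᵀ ξ) :=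
    integral_map (measurable_mApp _).aemeasurable
      ((measurable_fourierChar_inner x).mul (measurable_pull A β hg)).aestronglyMeasurable
  rw [hmap, integral_smul_measure, ENNReal.toReal_ofReal hc.le] at h
  rw [← Complex.real_smul, h]
  refine integral_congr_ae (Filter.Eventually.of_forall fun ξ => ?_)
  simp only [pull_mApp hA, inner_add_right, inner_mApp, AddChar.map_add_eq_mul, Circle.coe_mul]
  ring

/-- The samples of a band-limited function on `{A z + β}` in terms of the periodization of its
spectrum. -/
theorem sampleSum1_eq {F : L2 d ≃ₗᵢ[ℂ] L2 d} (hF : IsFourier F)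
    (hA : IsUnit A.det) (β : Rd d) (hc : 0 < c)
    (hmap : (volume : Measure (Rd d)).map (mApp Aᵀ) = ENNReal.ofReal c • volume)
    {g : Rd d → ℂ} (hg : Measurable g) (hi : Integrable g) {f : L2 d} {f₀ : Rd d → ℂ}
    (hf : IsCRep f f₀) (hfg : (F f : Rd d → ℂ) =ᵐ[volume] g)
    (h2 : ∫⁻ x in cell d, ‖∑' k : Fin d → ℤ, pull A β g (x + zv k)‖ₑ ^ 2 < ∞) :
    sampleSum1 A β f₀ = ENNReal.ofReal c ^ 2 *
      ∫⁻ x in cell d, ‖∑' k : Fin d → ℤ, pull A β g (x + zv k)‖ₑ ^ 2 := by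
  rw [← tsum_enorm_sq_integral (measurable_pull A β hg) (integrable_pull hA β hc hmap hg hi) h2,
    ← ENNReal.tsum_mul_left]
  refine tsum_congr fun z => ?_
  rw [hf.eq_integral hF (hi.congr hfg.symm)]
  have : ∫ ξ, (Real.fourierChar ⟪ξ, mApp A (zv z) + β⟫ : ℂ) * (F f : Rd d → ℂ) ξ =
      ∫ ξ, (Real.fourierChar ⟪ξ, mApp A (zv z) + β⟫ : ℂ) * g ξ := by
    refine integral_congr_ae ?_
    filter_upwards [hfg] with ξ hξ
    rw [hξ]
  rw [this, integral_mul_pull hA β (zv z) hc hmap hg]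
  change ‖(_ : ℂ)‖ₑ ^ 2 = _
  rw [enorm_mul, mul_pow, ← ofReal_norm (c : ℂ), Complex.norm_real, Real.norm_of_nonneg hc.le]

end ChangeOfVariables

theorem enorm_tsum_mul_sq_le {ι : Type*} [Countable ι] (a : ι → ℝ≥0∞) (h : ι → ℂ)
    (ha : ∀ i, a i = 0 ∨ a i = 1) (hh : ∀ i, a i = 0 → h i = 0) :
    ‖∑' i, h i‖ₑ ^ 2 ≤ (∑' i, a i) * ∑' i, ‖h i‖ₑ ^ 2 := by
  let _ : MeasurableSpace ι := ⊤
  have h1 : ‖∑' i, h i‖ₑ ≤ ∑' i, a i * ‖h i‖ₑ := by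
    refine enorm_tsum_le_tsum_enorm.trans (ENNReal.tsum_le_tsum fun i => ?_)
    rcases ha i with h0 | h0
    · simp [h0, hh i h0]
    · simp [h0]
  have h2 := ENNReal.lintegral_mul_le_Lp_mul_Lq (Measure.count : Measure ι)
    Real.HolderConjugate.two_two (f := a) (g := fun i => ‖h i‖ₑ)
    (measurable_from_top).aemeasurable (measurable_from_top).aemeasurable
  simp only [lintegral_count, Pi.mul_apply] at h2
  have h3 : ∀ i, a i ^ (2 : ℝ) = a i := by
    intro i
    rcases ha i with h0 | h0 <;> simp [h0]
  simp only [h3] at h2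
  calc ‖∑' i, h i‖ₑ ^ 2 ≤ _ := pow_le_pow_left' (h1.trans h2) 2
    _ = _ := by
      rw [mul_pow, ← ENNReal.rpow_natCast, ← ENNReal.rpow_natCast, ← ENNReal.rpow_mul,
        ← ENNReal.rpow_mul]
      simp

/-- The number of integer translates of `ξ` that `B` maps into `E`. -/
def latticeCount {d : ℕ} (E : Set (Rd d)) (B : Matrix (Fin d) (Fin d) ℝ) (ξ : Rd d) : ℝ≥0∞ :=
  ∑' k : Fin d → ℤ, E.indicator (fun _ => (1 : ℝ≥0∞)) (mApp B (ξ + zv k))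

theorem measurable_indicator_mApp {d : ℕ} {E : Set (Rd d)} (hE : MeasurableSet E)
    (B : Matrix (Fin d) (Fin d) ℝ) :
    Measurable fun ξ => E.indicator (fun _ => (1 : ℝ≥0∞)) (mApp B ξ) :=
  (measurable_const.indicator hE).comp (measurable_mApp B)

theorem measurable_latticeCount {d : ℕ} {E : Set (Rd d)} (hE : MeasurableSet E)
    (B : Matrix (Fin d) (Fin d) ℝ) : Measurable (latticeCount E B) :=
  Measurable.tsum fun k =>
    (measurable_indicator_mApp hE B).comp (measurable_add_const (zv k))

theorem latticeCount_add {d : ℕ} (E : Set (Rd d)) (B : Matrix (Fin d) (Fin d) ℝ) (ξ : Rd d)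
    (l : Fin d → ℤ) : latticeCount E B (ξ + zv l) = latticeCount E B ξ := by
  simp only [latticeCount, add_assoc, ← zv_add]
  exact (Equiv.addLeft l).tsum_eq
    (fun k => E.indicator (fun _ => (1 : ℝ≥0∞)) (mApp B (ξ + zv k)))

theorem ae_cell_add {d : ℕ} {p : Rd d → Prop} (hp : MeasurableSet {x | p x})
    (hper : ∀ (l : Fin d → ℤ) x, p (x + zv l) ↔ p x)
    (h : volume ({x | ¬ p x} ∩ cell d) = 0) : ∀ᵐ x, p x := by
  have hm : MeasurableSet {x : Rd d | ¬ p x} := hp.compl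
  rw [ae_iff, ← lintegral_indicator_one hm, lintegral_eq_tsum_cell, ENNReal.tsum_eq_zero]
  intro k
  have : ∀ x : Rd d, Set.indicator {x : Rd d | ¬ p x} (1 : Rd d → ℝ≥0∞) (x + zv k) =
      Set.indicator {x : Rd d | ¬ p x} 1 x := by
    intro x
    simp only [Set.indicator_apply, Set.mem_ofPred_eq, hper, Pi.one_apply]
  simp only [this]
  rw [lintegral_indicator_one hm, Measure.restrict_apply hm, h]

theorem integrable_of_L2_band {d : ℕ} {E : Set (Rd d)} (hE : IsBand E) (u : L2 d) :
    Integrable (E.indicator (u : Rd d → ℂ)) := by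
  have : IsFiniteMeasure ((volume : Measure (Rd d)).restrict E) :=
    ⟨by simpa using hE.2⟩
  rw [integrable_indicator_iff hE.1]
  exact ((Lp.memLp u).restrict E).integrable (by norm_num)

section Criterion

variable {d : ℕ} {A : Matrix (Fin d) (Fin d) ℝ} {c : ℝ} {F : L2 d ≃ₗᵢ[ℂ] L2 d} {E : Set (Rd d)}

theorem sampleSum1_le (hF : IsFourier F) (hE : IsBand E)
    (hA : IsUnit A.det) (β : Rd d) (hc : 0 < c)
    (hmap : (volume : Measure (Rd d)).map (mApp Aᵀ) = ENNReal.ofReal c • volume)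
    {M : ℝ≥0∞} (hM : M < ∞) (hcount : ∀ᵐ ξ, latticeCount E (Aᵀ)⁻¹ ξ ≤ M)
    {f : L2 d} (hfE : f ∈ Vband F E) {f₀ : Rd d → ℂ} (hf : IsCRep f f₀) :
    sampleSum1 A β f₀ ≤ ENNReal.ofReal c * M * (‖f‖₊ : ℝ≥0∞) ^ 2 := by
  set g : Rd d → ℂ := E.indicator (F f : Rd d → ℂ) with hgdef
  have hg : Measurable g := (Lp.stronglyMeasurable (F f)).measurable.indicator hE.1
  have hfg : (F f : Rd d → ℂ) =ᵐ[volume] g := by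
    filter_upwards [hfE] with ξ hξ
    by_cases h : ξ ∈ E
    · simp [hgdef, h]
    · simp [hgdef, h, hξ h]
  have hnorm : (‖f‖₊ : ℝ≥0∞) ^ 2 = ENNReal.ofReal c * ∫⁻ η, ‖pull A β g η‖ₑ ^ 2 := by
    rw [lintegral_enorm_pull_sq hA β hmap hg, ← enorm_sq_L2 hfg, F.nnnorm_map]
  have hle : ∫⁻ x in cell d, ‖∑' k : Fin d → ℤ, pull A β g (x + zv k)‖ₑ ^ 2 ≤
      M * ∫⁻ η, ‖pull A β g η‖ₑ ^ 2 := by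
    rw [lintegral_eq_tsum_cell (fun η => ‖pull A β g η‖ₑ ^ 2), ← lintegral_tsum,
      ← lintegral_const_mul']
    · refine lintegral_mono_ae ?_
      filter_upwards [ae_restrict_of_ae hcount] with x hx
      refine (enorm_tsum_mul_sq_le
        (fun k => E.indicator (fun _ => (1 : ℝ≥0∞)) (mApp (Aᵀ)⁻¹ (x + zv k))) _
        (fun k => ?_) (fun k hk => ?_)).trans (mul_le_mul_left hx _)
      · by_cases h : mApp (Aᵀ)⁻¹ (x + zv k) ∈ E <;> simp [h]
      · have : mApp (Aᵀ)⁻¹ (x + zv k) ∉ E := by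
          intro h
          simp [h] at hk
        simp [pull, hgdef, this]
    · exact hM.ne
    · exact fun k => (((measurable_pull A β hg).comp
        (measurable_add_const (zv k))).enorm.pow_const 2).aemeasurable
  have hfin : ∫⁻ η, ‖pull A β g η‖ₑ ^ 2 < ∞ := by
    refine ENNReal.lt_top_of_mul_ne_top_right (a := ENNReal.ofReal c) ?_ (by simpa using hc)
    rw [← hnorm]
    simp
  rw [sampleSum1_eq hF hA β hc hmap hg (integrable_of_L2_band hE _) hf hfg
    (hle.trans_lt (ENNReal.mul_lt_top hM hfin)), hnorm]
  calc _ ≤ ENNReal.ofReal c ^ 2 * (M * ∫⁻ η, ‖pull A β g η‖ₑ ^ 2) := by gcongr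
    _ = _ := by ring

theorem latticeCount_lt_top (hE : IsBand E) (hA : IsUnit A.det) (hc : 0 < c)
    (hmap : (volume : Measure (Rd d)).map (mApp Aᵀ) = ENNReal.ofReal c • volume) :
    ∀ᵐ ξ ∂(volume.restrict (cell d)), latticeCount E (Aᵀ)⁻¹ ξ < ∞ := by
  refine ae_lt_top (measurable_latticeCount hE.1 _) ?_
  simp only [latticeCount]
  have hm (k : Fin d → ℤ) : AEMeasurable
      (fun ξ => E.indicator (fun _ => (1 : ℝ≥0∞)) (mApp (Aᵀ)⁻¹ (ξ + zv k)))
      (volume.restrict (cell d)) :=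
    ((measurable_indicator_mApp hE.1 _).comp (measurable_add_const (zv k))).aemeasurable
  rw [lintegral_tsum hm,
    ← lintegral_eq_tsum_cell (fun ξ => E.indicator (fun _ => (1 : ℝ≥0∞)) (mApp (Aᵀ)⁻¹ ξ))]
  have h := lintegral_comp_mApp hmap (measurable_indicator_mApp hE.1 (Aᵀ)⁻¹)
  simp only [mApp_mApp, Matrix.nonsing_inv_mul _ ((Matrix.det_transpose A).symm ▸ hA),
    mApp_one] at h
  rw [lintegral_indicator_const hE.1, one_mul] at h
  exact (ENNReal.lt_top_of_mul_ne_top_right (h ▸ hE.2.ne) (by simpa using hc)).ne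

/-- The weight `1 / N` on the set where the lattice count `N` exceeds `K`. -/
def weight (E : Set (Rd d)) (B : Matrix (Fin d) (Fin d) ℝ) (K : ℝ≥0∞) (ξ : Rd d) : ℝ≥0∞ :=
  {ξ | K < latticeCount E B ξ}.indicator (fun ξ => (latticeCount E B ξ)⁻¹) ξ

/-- The extremal spectrum concentrated where the lattice count exceeds `K`. -/
def extremal (E : Set (Rd d)) (B : Matrix (Fin d) (Fin d) ℝ) (K : ℝ≥0∞) (η : Rd d) : ℂ :=
  ((E.indicator (fun _ => (1 : ℝ≥0∞)) (mApp B η) * weight E B K η).toReal : ℂ)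

variable {B : Matrix (Fin d) (Fin d) ℝ} {K : ℝ≥0∞}

theorem weight_le (hK : 1 ≤ K) (ξ : Rd d) : weight E B K ξ ≤ 1 := by
  unfold weight
  by_cases h : K < latticeCount E B ξ
  · rw [Set.indicator_of_mem (by exact h)]
    exact ENNReal.inv_le_one.2 (hK.trans h.le)
  · rw [Set.indicator_of_notMem (by exact h)]
    exact zero_le_one

theorem weight_add (ξ : Rd d) (l : Fin d → ℤ) : weight E B K (ξ + zv l) = weight E B K ξ := by
  simp only [weight, Set.indicator_apply, Set.mem_ofPred_eq, latticeCount_add]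

theorem measurable_weight (hE : MeasurableSet E) : Measurable (weight E B K) :=
  (measurable_latticeCount hE B).inv.indicator
    (measurableSet_lt measurable_const (measurable_latticeCount hE B))

theorem measurable_extremal (hE : MeasurableSet E) : Measurable (extremal E B K) :=
  Complex.measurable_ofReal.comp
    ((measurable_indicator_mApp hE B).mul (measurable_weight hE)).ennreal_toReal

theorem indicator_mul_weight_ne_top (hK : 1 ≤ K) (y ξ : Rd d) :
    E.indicator (fun _ => (1 : ℝ≥0∞)) y * weight E B K ξ ≠ ∞ := by
  refine ENNReal.mul_ne_top ?_ ((weight_le hK ξ).trans_lt ENNReal.one_lt_top).ne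
  by_cases h : y ∈ E <;> simp [h]

theorem enorm_extremal (hK : 1 ≤ K) (η : Rd d) : ‖extremal E B K η‖ₑ =
    E.indicator (fun _ => (1 : ℝ≥0∞)) (mApp B η) * weight E B K η := by
  rw [extremal, ← ofReal_norm, Complex.norm_real, Real.norm_of_nonneg ENNReal.toReal_nonneg,
    ENNReal.ofReal_toReal (indicator_mul_weight_ne_top hK _ _)]

theorem tsum_extremal (hK : 1 ≤ K) (x : Rd d) : ∑' k : Fin d → ℤ, extremal E B K (x + zv k) =
    ((latticeCount E B x * weight E B K x).toReal : ℂ) := by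
  simp only [extremal, weight_add]
  rw [← Complex.ofReal_tsum, ← ENNReal.tsum_toReal_eq
    (fun k => indicator_mul_weight_ne_top hK _ _), ENNReal.tsum_mul_right]
  rfl

theorem latticeCount_mul_weight_le (x : Rd d) : latticeCount E B x * weight E B K x ≤ 1 := by
  unfold weight
  by_cases h : K < latticeCount E B x
  · rw [Set.indicator_of_mem (by exact h)]
    exact ENNReal.mul_inv_le_one _
  · rw [Set.indicator_of_notMem (by exact h), mul_zero]
    exact zero_le_one

theorem enorm_tsum_extremal (hK : 1 ≤ K) (x : Rd d) :
    ‖∑' k : Fin d → ℤ, extremal E B K (x + zv k)‖ₑ = latticeCount E B x * weight E B K x := by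
  rw [tsum_extremal hK, ← ofReal_norm, Complex.norm_real,
    Real.norm_of_nonneg ENNReal.toReal_nonneg, ENNReal.ofReal_toReal
      ((latticeCount_mul_weight_le x).trans_lt ENNReal.one_lt_top).ne]

theorem tsum_enorm_extremal_sq (hK : 1 ≤ K) (x : Rd d) :
    ∑' k : Fin d → ℤ, ‖extremal E B K (x + zv k)‖ₑ ^ 2 ≤
      K⁻¹ * {ξ | K < latticeCount E B ξ}.indicator (fun _ => 1) x := by
  have h1 : ∀ k : Fin d → ℤ, ‖extremal E B K (x + zv k)‖ₑ ^ 2 =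
      E.indicator (fun _ => (1 : ℝ≥0∞)) (mApp B (x + zv k)) * weight E B K x ^ 2 := by
    intro k
    rw [enorm_extremal hK, weight_add]
    by_cases h : mApp B (x + zv k) ∈ E <;> simp [h]
  simp only [h1, ENNReal.tsum_mul_right]
  change latticeCount E B x * weight E B K x ^ 2 ≤ _
  rw [pow_two, ← mul_assoc]
  refine (mul_le_mul_left (latticeCount_mul_weight_le x) _).trans ?_
  rw [one_mul]
  unfold weight
  by_cases h : K < latticeCount E B x
  · rw [Set.indicator_of_mem (by exact h), Set.indicator_of_mem (by exact h), mul_one]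
    exact ENNReal.inv_le_inv.2 h.le
  · rw [Set.indicator_of_notMem (by exact h)]
    exact zero_le

theorem latticeCount_ae_le (hF : IsFourier F) (hE : IsBand E)
    (hA : IsUnit A.det) (β : Rd d) (hc : 0 < c)
    (hmap : (volume : Measure (Rd d)).map (mApp Aᵀ) = ENNReal.ofReal c • volume)
    {M : ℝ≥0∞} (hM : M < ∞) (hbound : ∀ f ∈ Vband F E, ∀ f₀, IsCRep f f₀ →
      sampleSum1 A β f₀ ≤ M * (‖f‖₊ : ℝ≥0∞) ^ 2) :
    ∀ᵐ ξ, latticeCount E (Aᵀ)⁻¹ ξ ≤ M / ENNReal.ofReal c + 1 := by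
  set C : ℝ≥0∞ := ENNReal.ofReal c with hC
  have hC0 : C ≠ 0 := by simpa [hC] using hc
  have hCt : C ≠ ∞ := ENNReal.ofReal_ne_top
  set K : ℝ≥0∞ := M / C + 1 with hKdef
  have hK : 1 ≤ K := le_add_self
  have hKt : K ≠ ∞ := ENNReal.add_ne_top.2 ⟨ENNReal.div_ne_top hM.ne hC0, ENNReal.one_ne_top⟩
  set B := (Aᵀ)⁻¹ with hB
  have hBA : B * Aᵀ = 1 := Matrix.nonsing_inv_mul _ ((Matrix.det_transpose A).symm ▸ hA)
  have hAB : Aᵀ * B = 1 := Matrix.mul_nonsing_inv _ ((Matrix.det_transpose A).symm ▸ hA)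
  set g : Rd d → ℂ := fun ξ => (Real.fourierChar (-⟪ξ, β⟫) : ℂ) * extremal E B K (mApp Aᵀ ξ)
    with hgdef
  have hg : Measurable g := by
    have h1 := measurable_fourierChar_inner (-β)
    simp only [inner_neg_right] at h1
    exact h1.mul ((measurable_extremal hE.1).comp (measurable_mApp _))
  have hpull : pull A β g = extremal E B K := by
    ext η
    simp only [pull, hgdef, ← hB, mApp_mApp, hAB, mApp_one]
    rw [← mul_assoc, ← Circle.coe_mul, ← AddChar.map_add_eq_mul]
    simp
  have hgnorm : ∀ ξ, ‖g ξ‖ₑ ≤ E.indicator (fun _ => 1) ξ := by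
    intro ξ
    simp only [hgdef, enorm_mul, enorm_fourierChar, one_mul]
    rw [enorm_extremal hK, mApp_mApp, hBA, mApp_one]
    exact (mul_le_mul_right (weight_le hK _) _).trans (mul_one _).le
  have hgi : Integrable g := by
    refine ⟨hg.aestronglyMeasurable, (lintegral_mono hgnorm).trans_lt ?_⟩
    rw [lintegral_indicator_const hE.1, one_mul]
    exact hE.2
  have hg2 : MemLp g 2 volume := by
    refine ⟨hg.aestronglyMeasurable, ?_⟩
    rw [eLpNorm_lt_top_iff_lintegral_rpow_enorm_lt_top (by norm_num) (by norm_num)]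
    refine (lintegral_mono fun ξ => ?_).trans_lt
      (b := ∫⁻ ξ, E.indicator (fun _ => (1 : ℝ≥0∞)) ξ) ?_
    · refine (ENNReal.rpow_le_rpow (hgnorm ξ) (by norm_num)).trans ?_
      by_cases h : ξ ∈ E <;> simp [h]
    · rw [lintegral_indicator_const hE.1, one_mul]
      exact hE.2
  set f : L2 d := F.symm hg2.toLp with hfdef
  have hFf : F f = hg2.toLp := F.apply_symm_apply _
  have hfg : (F f : Rd d → ℂ) =ᵐ[volume] g := by
    rw [hFf]
    exact hg2.coeFn_toLp
  have hfE : f ∈ Vband F E := by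
    filter_upwards [hfg] with ξ hξ hξE
    have := hgnorm ξ
    rw [Set.indicator_of_notMem hξE] at this
    rw [hξ]
    simpa using this
  obtain ⟨f₀, hf₀⟩ := exists_isCRep hF (hgi.congr hfg.symm)
  have hS : MeasurableSet {ξ : Rd d | K < latticeCount E B ξ} :=
    measurableSet_lt measurable_const (measurable_latticeCount hE.1 B)
  set σ : ℝ≥0∞ := volume ({ξ : Rd d | K < latticeCount E B ξ} ∩ cell d) with hσ
  have hσt : σ ≠ ∞ :=
    ((measure_mono Set.inter_subset_right).trans_lt
      ((volume_cell d).trans_lt ENNReal.one_lt_top)).ne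
  have hper : ∫⁻ x in cell d, ‖∑' k : Fin d → ℤ, extremal E B K (x + zv k)‖ₑ ^ 2 = σ := by
    rw [hσ, ← Measure.restrict_apply hS, ← lintegral_indicator_one hS]
    refine lintegral_congr_ae ?_
    filter_upwards [latticeCount_lt_top hE hA hc hmap] with x hx
    rw [enorm_tsum_extremal hK]
    unfold weight
    by_cases h : K < latticeCount E B x
    · rw [Set.indicator_of_mem (by exact h), Set.indicator_of_mem (by exact h),
        ENNReal.mul_inv_cancel (zero_le.trans_lt h).ne' hx.ne]
      simp
    · rw [Set.indicator_of_notMem (by exact h), Set.indicator_of_notMem (by exact h)]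
      simp
  have hsum := sampleSum1_eq hF hA β hc hmap hg hgi hf₀ hfg
    (by rw [hpull, hper]; exact hσt.lt_top)
  rw [hpull, hper] at hsum
  have hnorm : (‖f‖₊ : ℝ≥0∞) ^ 2 ≤ C * (K⁻¹ * σ) := by
    rw [← F.nnnorm_map, enorm_sq_L2 hfg, ← lintegral_enorm_pull_sq hA β hmap hg, hpull,
      lintegral_eq_tsum_cell, ← lintegral_tsum]
    · refine mul_le_mul_right ((lintegral_mono (tsum_enorm_extremal_sq hK)).trans ?_) _
      rw [lintegral_const_mul' _ _ (ENNReal.inv_ne_top.2 (zero_lt_one.trans_le hK).ne')]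
      refine mul_le_mul_right (le_of_eq ?_) _
      rw [lintegral_indicator_const hS, one_mul, Measure.restrict_apply hS]
    · exact fun k => (((measurable_extremal hE.1).comp
        (measurable_add_const (zv k))).enorm.pow_const 2).aemeasurable
  have hmain : C ^ 2 * σ ≤ M * (C * (K⁻¹ * σ)) :=
    hsum ▸ (hbound f hfE f₀ hf₀).trans (mul_le_mul_right hnorm _)
  have hzero : σ = 0 := by
    have h1 : C * (C * K * σ) ≤ C * (M * σ) := by
      calc C * (C * K * σ) = K * (C ^ 2 * σ) := by ring
        _ ≤ K * (M * (C * (K⁻¹ * σ))) := mul_le_mul_right hmain _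
        _ = (K * K⁻¹) * (C * (M * σ)) := by ring
        _ = C * (M * σ) := by
          rw [ENNReal.mul_inv_cancel (zero_lt_one.trans_le hK).ne' hKt, one_mul]
    have h2 := (ENNReal.mul_le_mul_iff_right hC0 hCt).1 h1
    rw [hKdef, mul_add, mul_one, ENNReal.mul_div_cancel hC0 hCt, add_mul] at h2
    have h3 : M * σ + C * σ ≤ M * σ + 0 := by simpa using h2
    have h4 := (ENNReal.add_le_add_iff_left (ENNReal.mul_ne_top hM.ne hσt)).1 h3
    simpa [hC0] using h4
  refine ae_cell_add (p := fun ξ => latticeCount E B ξ ≤ K)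
    (measurableSet_le (measurable_latticeCount hE.1 B) measurable_const)
    (fun l x => by rw [latticeCount_add]) ?_
  simpa only [not_le] using hzero

end Criterion

/-- boundedness criterion for the sampling transform, cf. [ALTW02a].
For a band `E`, matrices `A_j` and shifts `β_j`, the sampling transform
`Θ_A : V_E → ⊕ⁿ ℓ²(ℤ^d)`, `f ↦ ((f(A_j z + β_j))_z)_j` is well defined and bounded iff
for each `j` the `ℤ^d`-periodic function `ξ ↦ Σ_k χ_E(A_j^{*-1}(ξ + k))` is essentially
bounded. -/
theorem thetaBounded_iff_count_essBdd {d n : ℕ} (hd : 1 ≤ d) (hn : 1 ≤ n)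
    (F : L2 d ≃ₗᵢ[ℂ] L2 d) (hF : IsFourier F)
    (E : Set (Rd d)) (hE : IsBand E)
    (A : Fin n → Matrix (Fin d) (Fin d) ℝ) (hA : ∀ j, IsUnit (A j).det)
    (β : Fin n → Rd d) :
    ThetaBounded F E A β ↔
      ∀ j : Fin n, ∃ M : ℝ≥0∞, M < ⊤ ∧ ∀ᵐ ξ ∂(volume : Measure (Rd d)),
        (∑' k : Fin d → ℤ,
          E.indicator (fun _ => (1 : ℝ≥0∞)) (mApp ((A j)ᵀ)⁻¹ (ξ + zv k))) ≤ M := by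
  have hA' : ∀ j, ∃ c : ℝ, 0 < c ∧
      (volume : Measure (Rd d)).map (mApp (A j)ᵀ) = ENNReal.ofReal c • volume :=
    fun j => exists_map_mApp (by rw [Matrix.det_transpose]; exact hA j)
  choose c hc hmap using hA'
  constructor
  · rintro ⟨M, hM, hbound⟩ j
    refine ⟨M / ENNReal.ofReal (c j) + 1, ENNReal.add_lt_top.2
      ⟨(ENNReal.div_ne_top hM.ne (by simpa using hc j)).lt_top, ENNReal.one_lt_top⟩, ?_⟩
    refine latticeCount_ae_le hF hE (hA j) (β j) (hc j) (hmap j) hM fun f hf f₀ hf₀ => ?_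
    exact (ENNReal.le_tsum (f := fun j => sampleSum1 (A j) (β j) f₀) j).trans
      (hbound f hf f₀ hf₀)
  · intro h
    choose M hM hcount using h
    refine ⟨∑ j, ENNReal.ofReal (c j) * M j, ENNReal.sum_lt_top.2 fun j _ =>
      ENNReal.mul_lt_top ENNReal.ofReal_lt_top (hM j), fun f hf f₀ hf₀ => ?_⟩
    rw [Finset.sum_mul]
    change ∑' j, sampleSum1 (A j) (β j) f₀ ≤ _
    rw [tsum_fintype]
    exact Finset.sum_le_sum fun j _ =>
      sampleSum1_le hF hE (hA j) (β j) (hc j) (hmap j) (hM j) (hcount j) hf hf₀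

end GSL
end
end
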